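/- arXiv:2503.13995 — 4 statements merged into one kernel-verified Lean document; each statement's English description precedes it below -/
import Mathlib

section
/- Let G₁ = {g ∈ GL_n(K_v) : |det g| = 1}, with its topology as a subgroup of GL_n(K_v), let Γ₁ = GL_n(R_v) ≤ G₁, let X₁ = G₁/Γ₁ carry the quotient topology, and let A₁ be the subgroup of invertible diagonal matrices in G₁. For every g ∈ G₁ the following assertions are equivalent: (1) the orbit map A₁ → X₁, a ↦ (a g)Γ₁, is a proper map (the preimage of every compact subset of X₁ is compact); (2) there exist a ∈ A₁ and h ∈ GL_n(K) with |det h| = 1 such that g R_v^n = a h R_v^n (as subsets of K_v^n); (3) there exists an invertible diagonal matrix a ∈ GL_n(K_v) such that a·(g R_v^n) ⊆ R_v^n; (4) for every i ∈ {1,…,n} the intersection (K_v e_i) ∩ (g R_v^n) contains a nonzero vector. -/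
noncomputable section

open Polynomial
open scoped Classical

variable (Fq : Type) [Field Fq] [Fintype Fq]

/-- `K_v = F_q((Y⁻¹))`, realized as the field of Laurent series over `F_q`
in the uniformizer `π_v = Y⁻¹`. -/
abbrev Kv := LaurentSeries Fq

/-- The uniformizer `π_v = Y⁻¹` of `K_v`. -/
def piv : Kv Fq := HahnSeries.single (1 : ℤ) (1 : Fq)

/-- The element `Y = π_v⁻¹ ∈ K_v`. -/
def Yv : Kv Fq := HahnSeries.single (-1 : ℤ) (1 : Fq)

/-- The embedding `R_v = F_q[Y] → K_v`, `f ↦ f(Y)`. -/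
def polyEmb : Polynomial Fq →+* Kv Fq := Polynomial.eval₂RingHom HahnSeries.C (Yv Fq)

/-- `R_v = F_q[Y]`, as a subring of `K_v`. -/
def Rv : Subring (Kv Fq) := (polyEmb Fq).range

/-- `K = F_q(Y)`, the fraction field of `R_v`, as a subfield of `K_v`. -/
def Ksub : Subfield (Kv Fq) := Subfield.closure (Rv Fq : Set (Kv Fq))

/-- The normalized absolute value `|x| = q^{-v(x)}` on `K_v`, where `q = Card F_q`. -/
def absv (x : Kv Fq) : ℝ := if x = 0 then 0 else (Fintype.card Fq : ℝ) ^ (-x.order)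

/-- `x ∈ π_v^ℓ O_v`. -/
def inPiPow (ℓ : ℤ) (x : Kv Fq) : Prop := x = 0 ∨ ℓ ≤ x.order

variable (n : ℕ)

/-- The sup norm `‖x‖ = max_i |x_i|` on `K_v^n`. -/
def vnorm (x : Fin n → Kv Fq) : ℝ := ⨆ i, absv Fq (x i)

/-- The `R_v`-lattice `g R_v^n` in `K_v^n` associated with a matrix `g`. -/
def latticeSet (g : Matrix (Fin n) (Fin n) (Kv Fq)) : Set (Fin n → Kv Fq) :=
  {x | ∃ p : Fin n → Polynomial Fq, x = g.mulVec fun i => polyEmb Fq (p i)}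

/-- `R_v^n` as a subset of `K_v^n`. -/
def RvN : Set (Fin n → Kv Fq) := {x | ∀ i, x i ∈ Rv Fq}

lemma absv_zero : absv Fq 0 = 0 := if_pos rfl

lemma absv_one : absv Fq 1 = 1 := by
  rw [absv, if_neg one_ne_zero, HahnSeries.order_one]
  simp

lemma absv_mul (x y : Kv Fq) : absv Fq (x * y) = absv Fq x * absv Fq y := by
  rcases eq_or_ne x 0 with rfl | hx
  · simp [absv]
  rcases eq_or_ne y 0 with rfl | hy
  · simp [absv]
  have hxy : x * y ≠ 0 := mul_ne_zero hx hy
  have hq : (0 : ℝ) < (Fintype.card Fq : ℝ) := by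
    exact_mod_cast Fintype.card_pos
  rw [absv, absv, absv, if_neg hxy, if_neg hx, if_neg hy,
    HahnSeries.order_mul hx hy, neg_add, zpow_add₀ (ne_of_gt hq)]

/-- `GL_n(K_v)`. -/
abbrev GLn := (Matrix (Fin n) (Fin n) (Kv Fq))ˣ

/-- The unimodular group `G₁ = {g ∈ GL_n(K_v) : |det g| = 1}`. -/
def G1 : Subgroup (GLn Fq n) where
  carrier := {g | absv Fq ((g : Matrix (Fin n) (Fin n) (Kv Fq)).det) = 1}
  one_mem' := by
    simp only [Set.mem_setOf_eq, Units.val_one, Matrix.det_one]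
    exact absv_one Fq
  mul_mem' := by
    intro a b ha hb
    simp only [Set.mem_setOf_eq, Units.val_mul, Matrix.det_mul, absv_mul] at *
    rw [ha, hb, mul_one]
  inv_mem' := by
    intro a ha
    simp only [Set.mem_setOf_eq] at *
    have h : absv Fq ((a : Matrix (Fin n) (Fin n) (Kv Fq)).det) *
        absv Fq (((a⁻¹ : GLn Fq n) : Matrix (Fin n) (Fin n) (Kv Fq)).det) = 1 := by
      rw [← absv_mul, ← Matrix.det_mul, ← Units.val_mul, mul_inv_cancel,
        Units.val_one, Matrix.det_one, absv_one]
    rw [ha, one_mul] at h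
    exact h

set_option maxHeartbeats 1000000 in
/-- `Γ₁ = GL_n(R_v)`, as a subgroup of `GL_n(K_v)`. -/
def Gamma1 : Subgroup (GLn Fq n) :=
  (Units.map (RingHom.mapMatrix (Rv Fq).subtype).toMonoidHom).range

/-- The space `X₁ = G₁/Γ₁` with its quotient topology. -/
def X1 := G1 Fq n ⧸ Subgroup.comap (G1 Fq n).subtype (Gamma1 Fq n)

instance : TopologicalSpace (X1 Fq n) := instTopologicalSpaceQuotient

/-- The diagonal subgroup `A₁` of `G₁` (as a topological subspace of `G₁`). -/
def A1 := {a : G1 Fq n // ((a : GLn Fq n) : Matrix (Fin n) (Fin n) (Kv Fq)).IsDiag}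

instance : TopologicalSpace (A1 Fq n) := instTopologicalSpaceSubtype

/-- The orbit map `A₁ → X₁`, `a ↦ (a g) Γ₁`. -/
def orbitMap (g : G1 Fq n) : A1 Fq n → X1 Fq n :=
  fun a => QuotientGroup.mk (a.1 * g)


/-- The matrix underlying an element of `G₁`. -/
def matOfG1 (g : G1 Fq n) : Matrix (Fin n) (Fin n) (Kv Fq) :=
  ((g : GLn Fq n) : Matrix (Fin n) (Fin n) (Kv Fq))

section Degree

variable {F : Type} [Field F]

/-- `x` has degree at most `m` in `Y`, that is, `|x| ≤ q ^ m`. -/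
def DegLE (x : Kv F) (m : ℤ) : Prop := ∀ j : ℤ, m < j → x.coeff (-j) = 0

namespace DegLE

lemma mono {x : Kv F} {m m' : ℤ} (h : DegLE x m) (hm : m ≤ m') : DegLE x m' :=
  fun j hj => h j (hm.trans_lt hj)

lemma zero (m : ℤ) : DegLE (0 : Kv F) m := fun _ _ => rfl

lemma neg {x : Kv F} {m : ℤ} (hx : DegLE x m) : DegLE (-x) m :=
  fun j hj => by simp [hx j hj]

lemma sum {ι : Type*} {s : Finset ι} {f : ι → Kv F} {m : ℤ} (h : ∀ i ∈ s, DegLE (f i) m) :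
    DegLE (∑ i ∈ s, f i) m :=
  fun j hj => by
    rw [HahnSeries.coeff_sum]
    exact Finset.sum_eq_zero fun i hi => h i hi j hj

lemma iff_coeff_lt {x : Kv F} {m : ℤ} : DegLE x m ↔ ∀ j < -m, x.coeff j = 0 :=
  ⟨fun h j hj => by simpa using h (-j) (by lia), fun h j hj => h (-j) (by lia)⟩

lemma coeff_mul_neg {x y : Kv F} {a b : ℤ} (hx : DegLE x a) (hy : DegLE y b) :
    (x * y).coeff (-(a + b)) = x.coeff (-a) * y.coeff (-b) := by
  rw [HahnSeries.coeff_mul, Finset.sum_eq_single (-a, -b)]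
  · rintro ⟨i, j⟩ hij hne
    rw [Finset.mem_antidiagonal] at hij
    obtain ⟨hi, hj, hij⟩ := hij
    have h1 : -a ≤ i := by
      by_contra! hlt
      exact hi (iff_coeff_lt.1 hx i hlt)
    have h2 : -b ≤ j := by
      by_contra! hlt
      exact hj (iff_coeff_lt.1 hy j hlt)
    exact absurd (Prod.ext (by simp at hij ⊢; lia) (by simp at hij ⊢; lia)) hne
  · intro h
    rw [Finset.mem_antidiagonal] at h
    by_cases hx0 : x.coeff (-a) = 0
    · simp [hx0]
    by_cases hy0 : y.coeff (-b) = 0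
    · simp [hy0]
    exact absurd ⟨hx0, hy0, by simp; ring⟩ h

lemma mul {x y : Kv F} {a b : ℤ} (hx : DegLE x a) (hy : DegLE y b) :
    DegLE (x * y) (a + b) := fun j hj => by
  have := (hx.mono (show a ≤ a + (j - (a + b)) by lia)).coeff_mul_neg hy
  rw [hx _ (by lia), zero_mul] at this
  convert this using 2
  ring

lemma one : DegLE (1 : Kv F) 0 := fun j hj => by
  rw [HahnSeries.coeff_one, if_neg (by lia)]

lemma prod_and_coeff {ι : Type*} {s : Finset ι} {f : ι → Kv F} {μ : ι → ℤ}
    (h : ∀ i ∈ s, DegLE (f i) (μ i)) :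
    DegLE (∏ i ∈ s, f i) (∑ i ∈ s, μ i) ∧
      (∏ i ∈ s, f i).coeff (-∑ i ∈ s, μ i) = ∏ i ∈ s, (f i).coeff (-μ i) := by
  induction s using Finset.induction_on with
  | empty => simpa using DegLE.one
  | insert a s ha ih =>
    obtain ⟨h1, h2⟩ := ih fun i hi => h i (Finset.mem_insert_of_mem hi)
    have h0 := h a (Finset.mem_insert_self _ _)
    simp only [Finset.prod_insert ha, Finset.sum_insert ha]
    exact ⟨h0.mul h1, by rw [h0.coeff_mul_neg h1, h2]⟩

lemma single (m : ℤ) (c : F) : DegLE (HahnSeries.single (-m) c : Kv F) m :=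
  fun j hj => HahnSeries.coeff_single_of_ne (by lia)

lemma exists_degLE (x : Kv F) : ∃ m : ℕ, DegLE x m :=
  ⟨(-x.order).toNat, fun j hj => HahnSeries.coeff_eq_zero_of_lt_order (by lia)⟩

lemma neg_le_order {x : Kv F} {m : ℤ} (h : DegLE x m) (hx : x ≠ 0) : -m ≤ x.order := by
  by_contra! hlt
  exact HahnSeries.coeff_order_eq_zero.not.2 hx (by simpa using h (-x.order) (by lia))

lemma neg_order (x : Kv F) : DegLE x (-x.order) :=
  fun j hj => HahnSeries.coeff_eq_zero_of_lt_order (by lia)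

lemma eq_zero_of_forall {x : Kv F} (h : ∀ m : ℕ, ∃ k : ℤ, k ≤ -m ∧ DegLE x k) : x = 0 := by
  by_contra hx
  obtain ⟨k, hk, hxk⟩ := h (x.order.toNat + 1)
  have := hxk.neg_le_order hx
  lia

end DegLE

lemma absv_eq_one_iff [Fintype F] {x : Kv F} : absv F x = 1 ↔ x ≠ 0 ∧ x.order = 0 := by
  unfold absv
  split_ifs with hx
  · simp [hx]
  · have hq : (1 : ℝ) < Fintype.card F := by exact_mod_cast Fintype.one_lt_card
    simp only [ne_eq, hx, not_false_eq_true, true_and]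
    rw [zpow_eq_one_iff_right₀ (by linarith) hq.ne']
    lia

lemma polyEmb_C_mul_X_pow (c : F) (k : ℕ) :
    polyEmb F (C c * X ^ k) = HahnSeries.single (-(k : ℤ)) c := by
  simp [polyEmb, Yv, HahnSeries.single_pow, HahnSeries.C_apply, HahnSeries.single_mul_single]

lemma coeff_polyEmb (p : F[X]) (j : ℤ) :
    (polyEmb F p).coeff (-j) = if 0 ≤ j then p.coeff j.toNat else 0 := by
  induction p using Polynomial.induction_on' with
  | add p r hp hr =>
    rw [map_add, HahnSeries.coeff_add, hp, hr]
    split_ifs <;> simp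
  | monomial k c =>
    rw [← Polynomial.C_mul_X_pow_eq_monomial, polyEmb_C_mul_X_pow, HahnSeries.coeff_single,
      Polynomial.coeff_C_mul_X_pow]
    split_ifs <;> first | rfl | lia

lemma coeff_polyEmb_of_pos (p : F[X]) {j : ℤ} (hj : 0 < j) : (polyEmb F p).coeff j = 0 := by
  simpa [hj.not_ge] using coeff_polyEmb p (-j)

lemma natDegree_le_of_degLE {p : F[X]} {m : ℕ} (h : DegLE (polyEmb F p) m) :
    p.natDegree ≤ m := by
  rw [Polynomial.natDegree_le_iff_coeff_eq_zero]
  intro N hN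
  simpa [coeff_polyEmb] using h N (by lia)

lemma polyEmb_injective : Function.Injective (polyEmb F) := by
  intro p p' h
  ext k
  simpa [coeff_polyEmb] using congrArg (fun x : Kv F => x.coeff (-(k : ℤ))) h

lemma mem_Rv_iff {x : Kv F} : x ∈ Rv F ↔ ∀ j > 0, x.coeff j = 0 := by
  constructor
  · rintro ⟨p, rfl⟩ j hj
    exact coeff_polyEmb_of_pos p hj
  · intro h
    obtain ⟨m, hm⟩ := DegLE.exists_degLE x
    refine ⟨∑ k ∈ Finset.range (m + 1), C (x.coeff (-(k : ℤ))) * X ^ k, ?_⟩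
    ext j
    rcases lt_or_ge 0 j with hj | hj
    · rw [h j hj]
      exact coeff_polyEmb_of_pos _ hj
    · obtain ⟨k, rfl⟩ : ∃ k : ℕ, j = -k := ⟨(-j).toNat, by lia⟩
      rw [coeff_polyEmb]
      simp only [Nat.cast_nonneg, ↓reduceIte, Int.toNat_natCast, finsetSum_coeff,
        coeff_C_mul_X_pow, Finset.sum_ite_eq, Finset.mem_range]
      split_ifs with hk
      · rfl
      · exact (hm k (by lia)).symm

end Degree

section Reduction

open Matrix

variable {F : Type} [Field F] {n : ℕ}

/-- The vector of `K_v^n` given by a vector of polynomials. -/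
def embVec (p : Fin n → F[X]) : Fin n → Kv F := fun i => polyEmb F (p i)

/-- The matrix over `K_v` given by a matrix of polynomials. -/
abbrev embMat (γ : Matrix (Fin n) (Fin n) F[X]) : Matrix (Fin n) (Fin n) (Kv F) :=
  (polyEmb F).mapMatrix γ

lemma embMat_mulVec (γ : Matrix (Fin n) (Fin n) F[X]) (p : Fin n → F[X]) :
    embMat γ *ᵥ embVec p = embVec (γ *ᵥ p) := by
  ext1 i
  exact ((polyEmb F).map_mulVec γ p i).symm

lemma embVec_eq_zero {p : Fin n → F[X]} : embVec p = 0 ↔ p = 0 := by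
  simp only [funext_iff, embVec, Pi.zero_apply, map_eq_zero_iff _ polyEmb_injective]

/-- The lattice spanned by the columns of `G` has a nonzero vector of norm at most `q ^ m`. -/
def Short (G : Matrix (Fin n) (Fin n) (Kv F)) (m : ℤ) : Prop :=
  ∃ p : Fin n → F[X], p ≠ 0 ∧ ∀ i, DegLE ((G *ᵥ embVec p) i) m

lemma Short.mono {G : Matrix (Fin n) (Fin n) (Kv F)} {m m' : ℤ} (h : Short G m) (hm : m ≤ m') :
    Short G m' :=
  let ⟨p, hp, hG⟩ := h
  ⟨p, hp, fun i => (hG i).mono hm⟩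

lemma Short.of_mul {G : Matrix (Fin n) (Fin n) (Kv F)} {γ : (Matrix (Fin n) (Fin n) F[X])ˣ}
    {m : ℤ} (h : Short (G * embMat γ.1) m) : Short G m := by
  obtain ⟨p, hp, hG⟩ := h
  refine ⟨γ.1 *ᵥ p, fun h0 => hp ?_, fun i => ?_⟩
  · rw [← one_mulVec p, ← Units.inv_mul γ, ← mulVec_mulVec, h0, mulVec_zero]
  · rw [← embMat_mulVec, mulVec_mulVec]
    exact hG i

lemma short_mul_iff {G : Matrix (Fin n) (Fin n) (Kv F)} (γ : (Matrix (Fin n) (Fin n) F[X])ˣ)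
    {m : ℤ} : Short (G * embMat γ.1) m ↔ Short G m := by
  refine ⟨Short.of_mul, fun h => Short.of_mul (γ := γ⁻¹) ?_⟩
  rwa [mul_assoc, ← map_mul, Units.mul_inv, map_one, mul_one]

/-- The coefficients of degree `μ j` of the entries of the `j`-th columns. -/
def lead (B : Matrix (Fin n) (Fin n) (Kv F)) (μ : Fin n → ℤ) : Matrix (Fin n) (Fin n) F :=
  of fun i j => (B i j).coeff (-μ j)

lemma mulVec_coeff {B : Matrix (Fin n) (Fin n) (Kv F)} {μ : Fin n → ℤ} {x : Fin n → Kv F} {m : ℤ}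
    (hB : ∀ i j, DegLE (B i j) (μ j)) (hx : ∀ j, DegLE (x j) (m - μ j)) (i : Fin n) :
    ((B *ᵥ x) i).coeff (-m) = (lead B μ *ᵥ fun j => (x j).coeff (-(m - μ j))) i := by
  simp only [mulVec, dotProduct, HahnSeries.coeff_sum, lead, of_apply]
  refine Finset.sum_congr rfl fun j _ => ?_
  rw [← (hB i j).coeff_mul_neg (hx j)]
  congr 1
  ring

lemma mulVec_degLE {B : Matrix (Fin n) (Fin n) (Kv F)} {μ : Fin n → ℤ} {x : Fin n → Kv F} {m : ℤ}
    (hB : ∀ i j, DegLE (B i j) (μ j)) (hx : ∀ j, DegLE (x j) (m - μ j)) (i : Fin n) :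
    DegLE ((B *ᵥ x) i) m :=
  DegLE.sum fun j _ => by simpa using (hB i j).mul (hx j)

lemma det_degLE_and_coeff {B : Matrix (Fin n) (Fin n) (Kv F)} {μ : Fin n → ℤ}
    (hB : ∀ i j, DegLE (B i j) (μ j)) :
    DegLE B.det (∑ j, μ j) ∧ B.det.coeff (-∑ j, μ j) = (lead B μ).det := by
  have h (σ : Equiv.Perm (Fin n)) := DegLE.prod_and_coeff (s := Finset.univ)
    (f := fun j => B (σ j) j) (μ := μ) fun j _ => hB _ _
  rw [det_apply, det_apply]
  constructor
  · refine DegLE.sum fun σ _ => ?_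
    rcases Int.units_eq_one_or (Equiv.Perm.sign σ) with hσ | hσ <;> rw [hσ]
    · simpa using (h σ).1
    · simpa using (h σ).1.neg
  · rw [HahnSeries.coeff_sum]
    refine Finset.sum_congr rfl fun σ _ => ?_
    rcases Int.units_eq_one_or (Equiv.Perm.sign σ) with hσ | hσ <;> rw [hσ]
    · simpa [lead] using (h σ).2
    · simpa [lead] using (h σ).2

/-- The columns of `B` are orthogonal in the nonarchimedean sense, with norms `q ^ μ j`. -/
structure ColumnReduced (B : Matrix (Fin n) (Fin n) (Kv F)) (μ : Fin n → ℤ) : Prop where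
  degLE : ∀ i j, DegLE (B i j) (μ j)
  det_lead : (lead B μ).det ≠ 0

lemma degLE_of_mulVec_degLE {B : Matrix (Fin n) (Fin n) (Kv F)} {μ : Fin n → ℤ}
    (hB : ∀ i j, DegLE (B i j) (μ j)) {I S : Set (Fin n)}
    (hIS : ∀ c : Fin n → F, (∀ j ∉ S, c j = 0) → (∀ i ∈ I, (lead B μ *ᵥ c) i = 0) → c = 0)
    {x : Fin n → Kv F} (hxS : ∀ j ∉ S, x j = 0) {m : ℤ}
    (hx : ∀ i ∈ I, DegLE ((B *ᵥ x) i) m) (j : Fin n) : DegLE (x j) (m - μ j) := by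
  have key : ∀ k : ℕ, (∀ j, DegLE (x j) (m + k - μ j)) → ∀ j, DegLE (x j) (m - μ j) := by
    intro k
    induction k with
    | zero => simp
    | succ k ih =>
      intro h
      refine ih fun j l hl => ?_
      have hc := hIS (fun j => (x j).coeff (-(m + (k + 1 : ℕ) - μ j)))
        (fun j hj => by simp [hxS j hj])
        fun i hi => by rw [← mulVec_coeff hB h, hx i hi _ (by lia)]
      rcases (show m + (k + 1 : ℕ) - μ j ≤ l by push_cast; lia).eq_or_lt with rfl | hl'
      · exact congrFun hc j
      · exact h j l hl'
  choose d hd using fun j => DegLE.exists_degLE (x j)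
  refine key (∑ j, ((d j : ℤ) - m + μ j).toNat) (fun j => (hd j).mono ?_) j
  have := Finset.single_le_sum (f := fun j => ((d j : ℤ) - m + μ j).toNat)
    (fun _ _ => Nat.zero_le _) (Finset.mem_univ j)
  lia

lemma ColumnReduced.degLE_of_mulVec {B : Matrix (Fin n) (Fin n) (Kv F)} {μ : Fin n → ℤ}
    (hB : ColumnReduced B μ) {x : Fin n → Kv F} {m : ℤ} (hx : ∀ i, DegLE ((B *ᵥ x) i) m)
    (j : Fin n) : DegLE (x j) (m - μ j) := by
  refine degLE_of_mulVec_degLE hB.degLE (I := Set.univ) (S := Set.univ) (fun c _ hc => ?_)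
    (by simp) (fun i _ => hx i) j
  by_contra hc0
  exact hB.det_lead (exists_mulVec_eq_zero_iff.1 ⟨c, hc0, funext fun i => hc i trivial⟩)

lemma ColumnReduced.det_ne_zero_and_order {B : Matrix (Fin n) (Fin n) (Kv F)} {μ : Fin n → ℤ}
    (hB : ColumnReduced B μ) : B.det ≠ 0 ∧ B.det.order = -∑ j, μ j := by
  obtain ⟨h1, h2⟩ := det_degLE_and_coeff hB.degLE
  have h3 : B.det.coeff (-∑ j, μ j) ≠ 0 := h2 ▸ hB.det_lead
  have h0 : B.det ≠ 0 := fun h => h3 (by rw [h, HahnSeries.coeff_zero])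
  exact ⟨h0, le_antisymm (HahnSeries.order_le_of_coeff_ne_zero h3) (h1.neg_le_order h0)⟩

lemma det_embMat_unit (γ : (Matrix (Fin n) (Fin n) F[X])ˣ) :
    (embMat γ.1).det ≠ 0 ∧ (embMat γ.1).det.order = 0 := by
  obtain ⟨r, hr, hrγ⟩ := Polynomial.isUnit_iff.1 ((isUnit_iff_isUnit_det _).1 γ.isUnit)
  have : (embMat γ.1).det = HahnSeries.single 0 r := by
    rw [embMat, ← RingHom.map_det, ← hrγ]
    simpa using polyEmb_C_mul_X_pow r 0
  rw [this, HahnSeries.order_single hr.ne_zero]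
  exact ⟨by simpa using hr.ne_zero, rfl⟩

/-- If the leading coefficients of the columns are linearly dependent, then an elementary column
operation decreases the degree of some column. -/
lemma exists_column_operation {B : Matrix (Fin n) (Fin n) (Kv F)} {μ : Fin n → ℤ}
    (hB : ∀ i j, DegLE (B i j) (μ j)) (hdet : (lead B μ).det = 0) :
    ∃ (γ : (Matrix (Fin n) (Fin n) F[X])ˣ) (μ' : Fin n → ℤ),
      (∀ i j, DegLE ((B * embMat γ.1) i j) (μ' j)) ∧ ∑ j, μ' j = ∑ j, μ j - 1 := by
  obtain ⟨c, hc0, hc⟩ := exists_mulVec_eq_zero_iff.2 hdet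
  obtain ⟨j₀, hj₀, hmax⟩ : ∃ j₀, c j₀ ≠ 0 ∧ ∀ j, c j ≠ 0 → μ j ≤ μ j₀ := by
    obtain ⟨j₁, hj₁⟩ := Function.ne_iff.1 hc0
    obtain ⟨j₀, hj₀, hmax⟩ := Finset.exists_max_image (Finset.univ.filter fun j => c j ≠ 0) μ
      ⟨j₁, by simpa using hj₁⟩
    exact ⟨j₀, by simpa using hj₀, fun j hj => hmax j (by simpa using hj)⟩
  set v : Fin n → F[X] := fun j => C (c j) * X ^ (μ j₀ - μ j).toNat with hv
  have hembv (j : Fin n) : embVec v j = HahnSeries.single (-(μ j₀ - μ j)) (c j) := by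
    rw [embVec, hv, polyEmb_C_mul_X_pow]
    by_cases hcj : c j = 0
    · simp [hcj]
    · have := hmax j hcj
      congr 2
      lia
  have hunit : IsUnit ((1 : Matrix (Fin n) (Fin n) F[X]).updateCol j₀ v) := by
    rw [isUnit_iff_isUnit_det, ← cramer_apply, cramer_one, Module.End.one_apply, hv]
    simpa using hj₀
  refine ⟨hunit.unit, Function.update μ j₀ (μ j₀ - 1), fun i j => ?_, ?_⟩
  · have hcol : B * embMat hunit.unit.1 = B.updateCol j₀ (B *ᵥ embVec v) := by
      ext i j
      rcases eq_or_ne j j₀ with rfl | hj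
      · simp [mul_apply, mulVec, dotProduct, embVec]
      · simp [mul_apply, updateCol_ne hj, one_apply]
    rw [hcol]
    rcases eq_or_ne j j₀ with rfl | hj
    · have hx (k : Fin n) : DegLE (embVec v k) (μ j - μ k) := by
        rw [hembv]
        exact DegLE.single _ _
      simp only [updateCol_self, Function.update_self]
      intro l hl
      rcases (show μ j ≤ l by lia).eq_or_lt with rfl | hl'
      · rw [mulVec_coeff hB hx]
        simpa [hembv] using congrFun hc i
      · exact mulVec_degLE hB hx i l hl'
    · rw [updateCol_ne hj, Function.update_of_ne hj]
      exact hB i j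
  · rw [Finset.sum_update_of_mem (Finset.mem_univ _),
      ← Finset.add_sum_erase _ μ (Finset.mem_univ j₀),
      Finset.sdiff_singleton_eq_erase]
    ring

/-- Every lattice in `K_v^n` has an orthogonal basis. -/
lemma exists_columnReduced {G : Matrix (Fin n) (Fin n) (Kv F)} (hG : G.det ≠ 0) :
    ∃ (γ : (Matrix (Fin n) (Fin n) F[X])ˣ) (μ : Fin n → ℤ), ColumnReduced (G * embMat γ.1) μ := by
  have key : ∀ (N : ℕ) (γ : (Matrix (Fin n) (Fin n) F[X])ˣ) (μ : Fin n → ℤ),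
      (∀ i j, DegLE ((G * embMat γ.1) i j) (μ j)) → ∑ j, μ j + G.det.order ≤ N →
      ∃ (γ : (Matrix (Fin n) (Fin n) F[X])ˣ) (μ : Fin n → ℤ), ColumnReduced (G * embMat γ.1) μ := by
    intro N
    induction N with
    | zero =>
      intro γ μ hμ hN
      refine ⟨γ, μ, hμ, fun hdet => ?_⟩
      obtain ⟨γ', μ', hμ', hsum⟩ := exists_column_operation hμ hdet
      rw [mul_assoc, ← map_mul, ← Units.val_mul] at hμ'
      obtain ⟨h0, h1⟩ := det_embMat_unit (γ * γ')
      have h2 := (det_degLE_and_coeff hμ').1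
      rw [det_mul] at h2
      have h3 := h2.neg_le_order (mul_ne_zero hG h0)
      rw [HahnSeries.order_mul hG h0] at h3
      lia
    | succ N ih =>
      intro γ μ hμ hN
      by_cases hdet : (lead (G * embMat γ.1) μ).det = 0
      · obtain ⟨γ', μ', hμ', hsum⟩ := exists_column_operation hμ hdet
        rw [mul_assoc, ← map_mul, ← Units.val_mul] at hμ'
        exact ih _ _ hμ' (by lia)
      · exact ⟨γ, μ, hμ, hdet⟩
  choose d hd using fun i j => DegLE.exists_degLE (G i j)
  refine key (∑ j : Fin n, ∑ i, (d i j : ℤ) + G.det.order).toNat 1 (fun j => ∑ i, (d i j : ℤ))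
    (fun i j => ?_) (by lia)
  rw [Units.val_one, embMat, map_one, mul_one]
  exact (hd i j).mono (Finset.single_le_sum (f := fun i => (d i j : ℤ))
    (fun _ _ => Int.natCast_nonneg _) (Finset.mem_univ i))

end Reduction

section Ascent

open Matrix

variable {F : Type} [Field F] {n : ℕ}

/-- The diagonal matrix with entries `Y ^ k i`. -/
def scale (k : Fin n → ℤ) : Matrix (Fin n) (Fin n) (Kv F) :=
  diagonal fun i => HahnSeries.single (-k i) 1

lemma scale_add (k l : Fin n → ℤ) : scale (F := F) (k + l) = scale k * scale l := by
  simp only [scale, diagonal_mul_diagonal, HahnSeries.single_mul_single, Pi.add_apply, neg_add,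
    mul_one]

lemma scale_zero : scale (F := F) (0 : Fin n → ℤ) = 1 := by
  simp [scale]

lemma scale_mulVec (k : Fin n → ℤ) (x : Fin n → Kv F) (i : Fin n) :
    (scale k *ᵥ x) i = HahnSeries.single (-k i) 1 * x i := by
  rw [scale, mulVec_diagonal]

lemma degLE_single_mul_iff {x : Kv F} {k m : ℤ} :
    DegLE (HahnSeries.single (-k) 1 * x) m ↔ DegLE x (m - k) := by
  refine ⟨fun h => ?_, fun h => ?_⟩
  · have := (DegLE.single (-k) (1 : F)).mul h
    rwa [← mul_assoc, HahnSeries.single_mul_single, neg_neg, add_neg_cancel, mul_one,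
      HahnSeries.single_zero_one, one_mul, neg_add_eq_sub] at this
  · simpa using (DegLE.single k (1 : F)).mul h

lemma det_scale (k : Fin n → ℤ) :
    (scale (F := F) k).det = HahnSeries.single (-∑ i, k i) 1 := by
  rw [scale, det_diagonal]
  induction (Finset.univ : Finset (Fin n)) using Finset.induction_on with
  | empty => simp
  | insert a s ha ih =>
    rw [Finset.prod_insert ha, Finset.sum_insert ha, ih, HahnSeries.single_mul_single, mul_one,
      neg_add]

/-- A set of columns of an invertible matrix has a set of rows of the same cardinality on which
the columns remain linearly independent. -/
lemma exists_rows {Λ : Matrix (Fin n) (Fin n) F} (hΛ : Λ.det ≠ 0) (S : Finset (Fin n)) :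
    ∃ I : Finset (Fin n), I.card = S.card ∧ ∀ c : Fin n → F, (∀ j ∉ S, c j = 0) →
      (∀ i ∈ I, (Λ *ᵥ c) i = 0) → c = 0 := by
  set A : Matrix (Fin n) S F := Λ.submatrix id Subtype.val with hA
  have hcols : LinearIndependent F Λ.col :=
    linearIndependent_cols_iff_isUnit.2 ((isUnit_iff_isUnit_det _).2 hΛ.isUnit)
  have hAcols : LinearIndependent F A.col := hcols.comp _ Subtype.val_injective
  have hrank : A.rank = S.card := by
    rw [rank_eq_finrank_span_cols, finrank_span_eq_card hAcols, Fintype.card_coe]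
  obtain ⟨κ, a, ha, hspan, hli⟩ := exists_linearIndependent' F A.row
  have : Finite κ := Finite.of_injective a ha
  have := Fintype.ofFinite κ
  refine ⟨Finset.univ.image a, ?_, fun c hcS hc => ?_⟩
  · rw [Finset.card_image_of_injective _ ha, Finset.card_univ, ← finrank_span_eq_card hli, hspan,
      ← rank_eq_finrank_span_row, hrank]
  · have hAc (i : Fin n) : A.row i ⬝ᵥ (fun j : S => c j) = (Λ *ᵥ c) i := by
      rw [mulVec, dotProduct, dotProduct, ← Finset.sum_subset (Finset.subset_univ S)
        (fun j _ hj => by rw [hcS j hj, mul_zero]), ← Finset.sum_coe_sort S]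
      rfl
    have hzero : ∀ w ∈ Submodule.span F (Set.range (A.row ∘ a)), w ⬝ᵥ (fun j : S => c j) = 0 := by
      intro w hw
      induction hw using Submodule.span_induction with
      | mem w hw =>
        obtain ⟨k, rfl⟩ := hw
        rw [Function.comp_apply, hAc]
        exact hc _ (Finset.mem_image_of_mem _ (Finset.mem_univ _))
      | zero => simp
      | add w w' _ _ h h' => rw [add_dotProduct, h, h', add_zero]
      | smul r w _ h => rw [smul_dotProduct, h, smul_zero]
    by_contra hc0
    refine hΛ (exists_mulVec_eq_zero_iff.1 ⟨c, hc0, funext fun i => ?_⟩)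
    rw [← hAc]
    exact hzero _ (hspan ▸ Submodule.subset_span ⟨i, rfl⟩)

/-- Integers with sum zero one of which is very negative have a gap of length `n`. -/
lemma exists_gap {μ : Fin n → ℤ} (hsum : ∑ j, μ j = 0) {j₀ : Fin n}
    (hj₀ : μ j₀ < -(n : ℤ) * n) :
    ∃ t, μ j₀ ≤ t ∧ (∀ j, t < μ j → t + n ≤ μ j) ∧ ∃ j, t < μ j := by
  by_contra! hgap
  have hbound (i : ℕ) (hi : i ≤ n) : ∃ j, μ j₀ + i * n < μ j := by
    by_contra! hle
    have h1 : ∑ j, μ j ≤ ∑ _j : Fin n, (μ j₀ + i * n) := Finset.sum_le_sum fun j _ => hle j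
    rw [hsum, Finset.sum_const, Finset.card_univ, Fintype.card_fin, nsmul_eq_mul] at h1
    have hn : (0 : ℤ) < n := by exact_mod_cast j₀.pos
    have hi' : (i : ℤ) ≤ n := by exact_mod_cast hi
    have h2 : (i : ℤ) * n ≤ n * n := mul_le_mul_of_nonneg_right hi' hn.le
    have h3 : μ j₀ + i * n < 0 := by lia
    exact (mul_neg_of_pos_of_neg hn h3).not_ge h1
  have hcard : ∀ i : ℕ, i ≤ n → i + 1 ≤ (Finset.univ.filter fun j => μ j ≤ μ j₀ + i * n).card := by
    intro i
    induction i with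
    | zero =>
      intro _
      exact Finset.card_pos.2 ⟨j₀, by simp⟩
    | succ i ih =>
      intro hi
      refine Nat.succ_le_of_lt ((ih (by lia)).trans_lt (Finset.card_lt_card ?_))
      obtain ⟨j, hj⟩ := hbound i (by lia)
      have hcon : ¬ ∀ j, μ j₀ + i * n < μ j → μ j₀ + i * n + n ≤ μ j := fun h =>
        (hgap (μ j₀ + i * n) (le_add_of_nonneg_right (by positivity)) h j).not_gt hj
      push Not at hcon
      obtain ⟨l, hl, hl'⟩ := hcon
      refine (Finset.ssubset_iff_of_subset fun k hk => ?_).2 ⟨l, ?_, ?_⟩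
      · simp only [Finset.mem_filter, Finset.mem_univ, true_and] at hk ⊢
        push_cast
        nlinarith
      · simp only [Finset.mem_filter, Finset.mem_univ, true_and]
        push_cast
        nlinarith
      · simpa using hl
  have := (hcard n le_rfl).trans (Finset.card_le_univ _)
  rw [Fintype.card_fin] at this
  lia

lemma ColumnReduced.sum_eq_zero {G : Matrix (Fin n) (Fin n) (Kv F)} (hG : G.det ≠ 0)
    (hord : G.det.order = 0) {γ : (Matrix (Fin n) (Fin n) F[X])ˣ} {μ : Fin n → ℤ}
    (h : ColumnReduced (G * embMat γ.1) μ) : ∑ j, μ j = 0 := by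
  have h1 := h.det_ne_zero_and_order.2
  obtain ⟨h2, h3⟩ := det_embMat_unit γ
  rw [det_mul, HahnSeries.order_mul hG h2, hord, h3] at h1
  lia

lemma short_of_col {B : Matrix (Fin n) (Fin n) (Kv F)} {μ : Fin n → ℤ}
    (hB : ∀ i j, DegLE (B i j) (μ j)) (j : Fin n) : Short B (μ j) := by
  refine ⟨Pi.single j 1, by simp, fun i => ?_⟩
  have : embVec (Pi.single j (1 : F[X])) = Pi.single j (1 : Kv F) := by
    ext1 k
    rcases eq_or_ne k j with rfl | hk
    · simp [embVec]
    · simp [embVec, hk]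
  rw [this, mulVec_single_one]
  exact hB i j

/-- A lattice of covolume one has a nonzero vector of norm at most one. -/
lemma short_zero (hn : 0 < n) {G : Matrix (Fin n) (Fin n) (Kv F)} (hG : G.det ≠ 0)
    (hord : G.det.order = 0) : Short G 0 := by
  obtain ⟨γ, μ, hred⟩ := exists_columnReduced hG
  have hsum := hred.sum_eq_zero hG hord
  obtain ⟨j, hj⟩ : ∃ j, μ j ≤ 0 := by
    by_contra! hpos
    exact (Finset.sum_pos (fun j _ => hpos j) ⟨⟨0, hn⟩, Finset.mem_univ _⟩).ne' hsum
  exact (short_mul_iff γ).1 ((short_of_col hred.degLE j).mono hj)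

lemma nonneg_of_degLE_polyEmb {p : F[X]} (hp : p ≠ 0) {m : ℤ} (h : DegLE (polyEmb F p) m) :
    0 ≤ m := by
  by_contra! hm
  refine hp (Polynomial.ext fun k => ?_)
  simpa [coeff_polyEmb] using h k (by lia)

/-- If a lattice of covolume one has very short vectors, some diagonal matrix `Y ^ e` lengthens
its shortest vectors by the largest possible factor. -/
lemma exists_ascent {G : Matrix (Fin n) (Fin n) (Kv F)} (hG : G.det ≠ 0)
    (hord : G.det.order = 0) {m : ℤ} (hm : ¬ Short G m) (hs : Short G (-(n : ℤ) * n - 1)) :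
    ∃ (e : Fin n → ℤ) (d : ℤ), 0 < d ∧ ∑ i, e i = 0 ∧ (∀ i, e i ≤ d) ∧
      ¬ Short (scale e * G) (m + d) := by
  obtain ⟨γ, μ, hred⟩ := exists_columnReduced hG
  have hsum := hred.sum_eq_zero hG hord
  rw [← short_mul_iff γ] at hm hs
  set B := G * embMat γ.1 with hB
  have hμm (j : Fin n) : m < μ j := by
    by_contra! hle
    exact hm ((short_of_col hred.degLE j).mono hle)
  obtain ⟨p, hp, hpB⟩ := hs
  obtain ⟨j₁, hj₁⟩ := Function.ne_iff.1 hp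
  have hμj₁ := nonneg_of_degLE_polyEmb hj₁ (hred.degLE_of_mulVec hpB j₁)
  obtain ⟨j₀, -, hmin⟩ := Finset.exists_min_image Finset.univ μ ⟨j₁, Finset.mem_univ _⟩
  obtain ⟨t, ht, hgap, j₂, hj₂⟩ := exists_gap hsum (j₀ := j₀)
    (by have := hmin j₁ (Finset.mem_univ _); lia)
  set S := Finset.univ.filter fun j => μ j ≤ t with hS
  obtain ⟨I, hIS, hI⟩ := exists_rows hred.det_lead S
  have hSn : S.card < n := by
    conv_rhs => rw [← Fintype.card_fin n]
    exact Finset.card_lt_univ_of_notMem (x := j₂) (by simpa [hS] using hj₂)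
  refine ⟨fun i => if i ∈ I then (n : ℤ) - S.card else -S.card, n - S.card, by lia, ?_, fun i => ?_,
    ?_⟩
  · have hite (i : Fin n) : (if i ∈ I then (n : ℤ) - S.card else -S.card) =
        (if i ∈ I then (n : ℤ) else 0) - S.card := by split_ifs <;> ring
    simp only [hite, Finset.sum_sub_distrib, Finset.sum_ite_mem, Finset.univ_inter,
      Finset.sum_const, hIS, Finset.card_univ, Fintype.card_fin, nsmul_eq_mul]
    ring
  · dsimp only
    split_ifs <;> lia
  · rw [← short_mul_iff γ, mul_assoc, ← hB]
    rintro ⟨p, hp, hpB⟩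
    simp only [← mulVec_mulVec, scale_mulVec, degLE_single_mul_iff] at hpB
    have hall (i : Fin n) : DegLE ((B *ᵥ embVec p) i) (m + n) :=
      (hpB i).mono (by split_ifs <;> lia)
    have hpS : ∀ j ∉ S, embVec p j = 0 := by
      intro j hj
      have h1 := hred.degLE_of_mulVec hall j
      have h2 : t < μ j := by simpa [hS] using hj
      have h3 := hgap j h2
      have h4 := hμm j₀
      rw [embVec]
      by_contra h0
      have := nonneg_of_degLE_polyEmb (fun h => h0 (by rw [h, map_zero])) h1
      lia
    have hdeg := degLE_of_mulVec_degLE hred.degLE (I := I) (S := S) hI hpS (m := m)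
      fun i hi => (hpB i).mono (by rw [if_pos (by simpa using hi)]; lia)
    exact hm ⟨p, hp, mulVec_degLE hred.degLE hdeg⟩

lemma det_scale_mul {G : Matrix (Fin n) (Fin n) (Kv F)} (hG : G.det ≠ 0) (hord : G.det.order = 0)
    {k : Fin n → ℤ} (hk : ∑ i, k i = 0) :
    (scale k * G).det ≠ 0 ∧ (scale k * G).det.order = 0 := by
  rw [det_mul, det_scale, hk, neg_zero, HahnSeries.single_zero_one, one_mul]
  exact ⟨hG, hord⟩

/-- If the diagonal translates of a lattice have very short vectors as soon as the `i₁`-th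
coordinate is strongly contracted, then their shortest vectors have norm `O(q ^ k i₁)`. -/
lemma short_scale_mul {G : Matrix (Fin n) (Fin n) (Kv F)} (hG : G.det ≠ 0)
    (hord : G.det.order = 0) {i₁ : Fin n} {M : ℤ}
    (hM : ∀ k : Fin n → ℤ, ∑ i, k i = 0 → k i₁ ≤ -M → Short (scale k * G) (-(n : ℤ) * n - 1))
    {k : Fin n → ℤ} (hk : ∑ i, k i = 0) : Short (scale k * G) (k i₁ + M) := by
  have key : ∀ (N : ℕ) (k : Fin n → ℤ) (m : ℤ), ∑ i, k i = 0 → k i₁ + M ≤ m → -m ≤ N →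
      Short (scale k * G) m := by
    intro N
    induction N with
    | zero =>
      intro k m hk _ hm
      obtain ⟨h1, h2⟩ := det_scale_mul hG hord hk
      exact (short_zero i₁.pos h1 h2).mono (by lia)
    | succ N ih =>
      intro k m hk hkm hm
      obtain ⟨h1, h2⟩ := det_scale_mul hG hord hk
      rcases le_or_gt 0 m with hm0 | hm0
      · exact (short_zero i₁.pos h1 h2).mono hm0
      by_contra hnot
      obtain ⟨e, d, hd, he, hed, hnot'⟩ := exists_ascent h1 h2 hnot (hM k hk (by lia))
      rw [← mul_assoc, ← scale_add] at hnot'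
      refine hnot' (ih _ _ ?_ ?_ (by lia))
      · simp [Finset.sum_add_distrib, hk, he]
      · have := hed i₁
        simp only [Pi.add_apply]
        lia
  exact key (-(k i₁ + M)).toNat k _ hk le_rfl (by lia)

lemma finite_natDegree_le [Finite F] (D : ℕ) :
    {p : Fin n → F[X] | ∀ j, (p j).natDegree ≤ D}.Finite := by
  have h : {p : F[X] | p.natDegree ≤ D}.Finite := by
    have : Finite (degreeLT F (D + 1)) := Finite.of_equiv _ (degreeLTEquiv F (D + 1)).symm.toEquiv
    refine (Set.toFinite (degreeLT F (D + 1) : Set F[X])).subset fun p hp => ?_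
    rw [SetLike.mem_coe, mem_degreeLT]
    exact degree_le_natDegree.trans_lt (by exact_mod_cast Nat.lt_succ_of_le hp)
  exact (Set.Finite.pi' fun _ => h)

/-- A lattice whose diagonal translates have very short vectors as soon as the `i₁`-th
coordinate is strongly contracted meets the `i₁`-th coordinate axis. -/
lemma exists_axis_vector [Finite F] {G : Matrix (Fin n) (Fin n) (Kv F)} (hG : G.det ≠ 0)
    (hord : G.det.order = 0) {i₁ : Fin n} {M : ℤ}
    (hM : ∀ k : Fin n → ℤ, ∑ i, k i = 0 → k i₁ ≤ -M → Short (scale k * G) (-(n : ℤ) * n - 1)) :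
    ∃ p : Fin n → F[X], p ≠ 0 ∧ ∀ i, i ≠ i₁ → (G *ᵥ embVec p) i = 0 := by
  obtain ⟨γ, μ, hred⟩ := exists_columnReduced hG
  have hN (N : ℕ) : ∃ p : Fin n → F[X], p ≠ 0 ∧
      (∀ i, DegLE (((G * embMat γ.1) *ᵥ embVec p) i) M) ∧
      ∀ i, i ≠ i₁ → DegLE (((G * embMat γ.1) *ᵥ embVec p) i) (M - N) := by
    have hn : (1 : ℤ) ≤ n := by exact_mod_cast i₁.pos
    set k : Fin n → ℤ := fun i => N - if i = i₁ then (n : ℤ) * N else 0 with hk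
    have hsum : ∑ i, k i = 0 := by
      simp [hk]
    obtain ⟨p, hp, hpG⟩ := (short_mul_iff γ).2 (short_scale_mul hG hord hM hsum)
    simp only [mul_assoc (scale k), ← mulVec_mulVec _ (scale k), scale_mulVec,
      degLE_single_mul_iff] at hpG
    have hpos : 0 ≤ (n - 1 : ℤ) * N := mul_nonneg (by lia) (by positivity)
    refine ⟨p, hp, fun i => (hpG i).mono ?_, fun i hi => (hpG i).mono ?_⟩
    · simp only [hk, if_true]
      split_ifs <;> nlinarith
    · simp only [hk, if_true, if_neg hi]
      nlinarith
  choose p hp hpM hpN using hN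
  set D := ∑ j, (M - μ j).toNat with hD
  have hpD (N : ℕ) : p N ∈ {p : Fin n → F[X] | ∀ j, (p j).natDegree ≤ D} := fun j => by
    refine natDegree_le_of_degLE ((hred.degLE_of_mulVec (hpM N) j).mono ?_)
    have := Finset.single_le_sum (f := fun j => (M - μ j).toNat)
      (fun _ _ => Nat.zero_le _) (Finset.mem_univ j)
    lia
  have := (finite_natDegree_le (F := F) (n := n) D).to_subtype
  obtain ⟨⟨p₀, hp₀⟩, hinf⟩ := Finite.exists_infinite_fiber
    fun N => (⟨p N, hpD N⟩ : {p : Fin n → F[X] | ∀ j, (p j).natDegree ≤ D})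
  rw [Set.infinite_coe_iff] at hinf
  obtain ⟨N₀, hN₀⟩ := hinf.nonempty
  have hpN₀ : p N₀ = p₀ := congrArg Subtype.val hN₀
  refine ⟨γ.1 *ᵥ p₀, fun h0 => hp N₀ ?_, fun i hi => DegLE.eq_zero_of_forall fun m => ?_⟩
  · rw [hpN₀, ← one_mulVec p₀, ← Units.inv_mul γ, ← mulVec_mulVec, h0, mulVec_zero]
  · obtain ⟨N, hN, hNm⟩ := hinf.exists_gt (M.toNat + m)
    refine ⟨M - N, by lia, ?_⟩
    rw [← embMat_mulVec, mulVec_mulVec, ← show p N = p₀ from congrArg Subtype.val hN]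
    exact hpN N i hi

end Ascent

section Topology

open Matrix Topology MonoidWithZeroHom.ValueGroup₀

variable {F : Type} [Field F] {n : ℕ}

lemma degLE_iff_valuation {x : Kv F} {m : ℤ} : DegLE x m ↔ Valued.v x ≤ WithZero.exp m := by
  rw [DegLE.iff_coeff_lt, ← LaurentSeries.valuation_le_iff_coeff_lt_eq_zero, neg_neg]

lemma isClopen_degLE (m : ℤ) : IsClopen {x : Kv F | DegLE x m} := by
  have hv : Valued.v (HahnSeries.single (-m) 1 : Kv F) = WithZero.exp m := by
    rw [LaurentSeries.valuation_single_zpow, neg_neg]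
  have := Valued.isClopen_closedBall (R := Kv F)
    (r := Valued.v.restrict (HahnSeries.single (-m) 1 : Kv F)) (by simp)
  simpa only [Valuation.restrict_le_iff, hv, ← degLE_iff_valuation] using this

lemma mem_nhds_iff_degLE {s : Set (Kv F)} {x : Kv F} :
    s ∈ 𝓝 x ↔ ∃ m : ℤ, {y | DegLE (y - x) m} ⊆ s := by
  constructor
  · intro hs
    obtain ⟨γ, hγ⟩ := Valued.mem_nhds.1 hs
    refine ⟨WithZero.log (embedding γ.1) - 1, fun y hy => hγ ?_⟩
    rw [Set.mem_ofPred_eq, Valuation.restrict_lt_iff_lt_embedding]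
    refine (degLE_iff_valuation.1 hy).trans_lt ?_
    rw [← WithZero.lt_log_iff_exp_lt (by simp)]
    simp
  · rintro ⟨m, hm⟩
    refine Filter.mem_of_superset (((isClopen_degLE m).isOpen.preimage
      (continuous_sub_right x)).mem_nhds ?_) hm
    simpa using DegLE.zero m

lemma isCompact_degLE [Finite F] (m : ℤ) : IsCompact {x : Kv F | DegLE x m} := by
  let _ : TopologicalSpace F := ⊥
  have : DiscreteTopology F := ⟨rfl⟩
  let φ : (ℕ → F) → Kv F := fun f =>
    HahnSeries.single (-m) 1 * HahnSeries.ofPowerSeries ℤ F (PowerSeries.mk f)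
  have hcoeff (f : ℕ → F) (j : ℤ) :
      (φ f).coeff j = if 0 ≤ j + m then f (j + m).toNat else 0 := by
    have h := HahnSeries.coeff_single_mul_add (r := (1 : F))
      (x := HahnSeries.ofPowerSeries ℤ F (PowerSeries.mk f)) (a := j + m) (b := -m)
    rw [add_neg_cancel_right, one_mul] at h
    rw [h, PowerSeries.coeff_coe]
    split_ifs <;> first | lia | simp
    congr 1
    lia
  have hφ : Continuous φ := by
    rw [continuous_iff_continuousAt]
    intro f s hs
    obtain ⟨l, hl⟩ := mem_nhds_iff_degLE.1 hs
    have hopen : IsOpen (⋂ k ∈ Finset.range (m - l).toNat, (fun g : ℕ → F => g k) ⁻¹' {f k}) :=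
      isOpen_biInter_finset fun k _ =>
        (isOpen_discrete ({f k} : Set F)).preimage (continuous_apply (A := fun _ => F) k)
    refine Filter.mem_map.2 (Filter.mem_of_superset (hopen.mem_nhds (x := f) (by simp))
      fun g hg => hl fun j hj => ?_)
    rw [HahnSeries.coeff_sub, hcoeff, hcoeff]
    split_ifs
    · have := Set.mem_iInter₂.1 hg (-j + m).toNat (Finset.mem_range.2 (by lia))
      rw [show g _ = f _ from this, sub_self]
    · simp
  convert isCompact_range hφ
  ext x
  constructor
  · intro hx
    refine ⟨fun k => x.coeff (k - m), ?_⟩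
    ext j
    rw [hcoeff]
    split_ifs
    · congr 1
      lia
    · simpa using (hx (-j) (by lia)).symm
  · rintro ⟨f, rfl⟩ j hj
    rw [hcoeff, if_neg (by lia)]

lemma isClosed_Rv : IsClosed (Rv F : Set (Kv F)) := by
  let _ : UniformSpace F := ⊥
  have : (Rv F : Set (Kv F)) = ⋂ j : ℤ, ⋂ _ : 0 < j, (fun x : Kv F => x.coeff j) ⁻¹' {0} := by
    ext x
    simp [mem_Rv_iff]
  rw [this]
  exact isClosed_iInter fun j => isClosed_iInter fun _ =>
    (isClosed_discrete _).preimage (LaurentSeries.uniformContinuous_coeff j).continuous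

/-- The invertible matrices `g` such that `g` and `g⁻¹` have norm at most `q ^ m`. -/
def unitBall (F : Type) [Field F] (n : ℕ) (m : ℤ) : Set (GLn F n) :=
  {g | ∀ i j, DegLE (g.1 i j) m ∧ DegLE (g⁻¹.1 i j) m}

lemma unitBall_mono {m m' : ℤ} (h : m ≤ m') : unitBall F n m ⊆ unitBall F n m' :=
  fun _ hg i j => ⟨(hg i j).1.mono h, (hg i j).2.mono h⟩

lemma exists_mem_unitBall (g : GLn F n) : ∃ m : ℕ, g ∈ unitBall F n m := by
  choose d hd using fun i j => DegLE.exists_degLE (g.1 i j)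
  choose e he using fun i j => DegLE.exists_degLE (g⁻¹.1 i j)
  refine ⟨∑ i, ∑ j, (d i j + e i j), fun i j => ?_⟩
  have h : d i j + e i j ≤ ∑ i, ∑ j, (d i j + e i j) :=
    (Finset.single_le_sum (f := fun j => d i j + e i j) (fun _ _ => Nat.zero_le _)
      (Finset.mem_univ j)).trans (Finset.single_le_sum (f := fun i => ∑ j, (d i j + e i j))
      (fun _ _ => Nat.zero_le _) (Finset.mem_univ i))
  exact ⟨(hd i j).mono (by lia), (he i j).mono (by lia)⟩

lemma continuous_entry (i j : Fin n) : Continuous fun g : GLn F n => g.1 i j :=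
  Units.continuous_val.matrix_elem i j

lemma continuous_inv_entry (i j : Fin n) : Continuous fun g : GLn F n => g⁻¹.1 i j :=
  (continuous_entry i j).comp continuous_inv

lemma isClopen_unitBall (m : ℤ) : IsClopen (unitBall F n m) := by
  have : unitBall F n m = ⋂ i, ⋂ j, ((fun g : GLn F n => g.1 i j) ⁻¹' {x | DegLE x m} ∩
      (fun g : GLn F n => g⁻¹.1 i j) ⁻¹' {x | DegLE x m}) := by
    ext g
    simp [unitBall]
  rw [this]
  exact isClopen_iInter_of_finite fun i => isClopen_iInter_of_finite fun j =>
    ((isClopen_degLE m).preimage (continuous_entry i j)).inter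
      ((isClopen_degLE m).preimage (continuous_inv_entry i j))

lemma isCompact_unitBall [Finite F] (m : ℤ) : IsCompact (unitBall F n m) := by
  have hmat : IsCompact {A : Matrix (Fin n) (Fin n) (Kv F) | ∀ i j, DegLE (A i j) m} :=
    isCompact_pi_infinite fun _ => isCompact_pi_infinite fun _ => isCompact_degLE m
  have hop := hmat.image (MulOpposite.continuous_op (M := Matrix (Fin n) (Fin n) (Kv F)))
  have hprod := Units.isClosedEmbedding_embedProduct.isCompact_preimage (hmat.prod hop)
  refine hprod.of_isClosed_subset (isClopen_unitBall m).isClosed fun g hg => ?_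
  exact ⟨fun i j => (hg i j).1, _, fun i j => (hg i j).2, rfl⟩

lemma mem_Gamma1_iff {g : GLn F n} :
    g ∈ Gamma1 F n ↔ ∃ γ : (Matrix (Fin n) (Fin n) F[X])ˣ, g.1 = embMat γ.1 := by
  constructor
  · rintro ⟨u, rfl⟩
    have hlift (A : Matrix (Fin n) (Fin n) (Rv F)) : ∃ B : Matrix (Fin n) (Fin n) F[X],
        (polyEmb F).mapMatrix B = (Rv F).subtype.mapMatrix A := by
      choose B hB using fun i j => (A i j).2
      exact ⟨of B, by ext1 i j; exact hB i j⟩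
    have hinj : Function.Injective ((polyEmb F).mapMatrix (m := Fin n)) :=
      map_injective polyEmb_injective
    obtain ⟨B, hB⟩ := hlift u.1
    obtain ⟨C, hC⟩ := hlift u⁻¹.1
    refine ⟨⟨B, C, hinj ?_, hinj ?_⟩, hB.symm⟩
    · rw [map_mul, map_one, hB, hC, ← map_mul, Units.mul_inv, map_one]
    · rw [map_mul, map_one, hB, hC, ← map_mul, Units.inv_mul, map_one]
  · rintro ⟨γ, hγ⟩
    refine ⟨Units.map ((polyEmb F).rangeRestrict.mapMatrix).toMonoidHom γ, Units.ext ?_⟩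
    rw [hγ]
    rfl

lemma isClosed_Gamma1 : IsClosed (Gamma1 F n : Set (GLn F n)) := by
  have : (Gamma1 F n : Set (GLn F n)) = ⋂ i, ⋂ j, ((fun g : GLn F n => g.1 i j) ⁻¹' Rv F ∩
      (fun g : GLn F n => g⁻¹.1 i j) ⁻¹' Rv F) := by
    ext g
    simp only [SetLike.mem_coe, Set.mem_iInter, Set.mem_inter_iff, Set.mem_preimage]
    constructor
    · intro hg i j
      obtain ⟨γ, hγ⟩ := mem_Gamma1_iff.1 hg
      obtain ⟨δ, hδ⟩ := mem_Gamma1_iff.1 (inv_mem hg)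
      rw [hγ, hδ]
      exact ⟨⟨_, rfl⟩, ⟨_, rfl⟩⟩
    · intro h
      have hinj : Function.Injective ((Rv F).subtype.mapMatrix (m := Fin n)) :=
        map_injective Subtype.val_injective
      refine ⟨⟨of fun i j => ⟨g.1 i j, (h i j).1⟩, of fun i j => ⟨g⁻¹.1 i j, (h i j).2⟩,
        hinj ?_, hinj ?_⟩, Units.ext rfl⟩
      · rw [map_mul, map_one]
        exact g.mul_inv
      · rw [map_mul, map_one]
        exact g.inv_mul
  rw [this]
  exact isClosed_iInter fun i => isClosed_iInter fun j =>
    (isClosed_Rv.preimage (continuous_entry i j)).inter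
      (isClosed_Rv.preimage (continuous_inv_entry i j))

lemma isClosed_G1 [Fintype F] : IsClosed (G1 F n : Set (GLn F n)) := by
  have : (G1 F n : Set (GLn F n)) = (fun g : GLn F n => g.1.det) ⁻¹'
      ({x | DegLE x 0} \ {x | DegLE x (-1)}) := by
    ext g
    have hdet : g.1.det ≠ 0 := ((isUnit_iff_isUnit_det _).1 g.isUnit).ne_zero
    refine (absv_eq_one_iff (x := g.1.det)).trans ⟨fun h => ⟨?_, fun h1 => ?_⟩, fun h => ⟨hdet, ?_⟩⟩
    · simpa [h.2] using DegLE.neg_order g.1.det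
    · have := DegLE.neg_le_order h1 hdet
      lia
    · have h1 := DegLE.neg_le_order h.1 hdet
      by_contra h2
      exact h.2 ((DegLE.neg_order g.1.det).mono (by lia))
  rw [this]
  exact (((isClopen_degLE 0).diff (isClopen_degLE (-1))).preimage
    (Continuous.matrix_det Units.continuous_val)).isClosed

lemma isClosed_isDiag : IsClosed {g : GLn F n | g.1.IsDiag} := by
  have : {g : GLn F n | g.1.IsDiag} =
      ⋂ i, ⋂ j, ⋂ _ : i ≠ j, (fun g : GLn F n => g.1 i j) ⁻¹' {0} := by
    ext g
    simp [IsDiag, Pairwise]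
  rw [this]
  exact isClosed_iInter fun i => isClosed_iInter fun j => isClosed_iInter fun _ =>
    isClosed_singleton.preimage (continuous_entry i j)

section

variable [Fintype F]

lemma isCompact_unitBall_G1 (m : ℤ) : IsCompact {g : G1 F n | g.1 ∈ unitBall F n m} :=
  isClosed_G1.isClosedEmbedding_subtypeVal.isCompact_preimage (isCompact_unitBall m)

lemma isCompact_unitBall_A1 (m : ℤ) : IsCompact {a : A1 F n | a.1.1 ∈ unitBall F n m} :=
  (isClosed_isDiag.preimage continuous_subtype_val).isClosedEmbedding_subtypeVal.isCompact_preimage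
    (isCompact_unitBall_G1 m)

/-- The projection `G₁ → X₁ = G₁/Γ₁`. -/
def toX1 (g : G1 F n) : X1 F n := QuotientGroup.mk g

lemma toX1_eq_iff {g u : G1 F n} : toX1 u = toX1 g ↔ u.1⁻¹ * g.1 ∈ Gamma1 F n :=
  QuotientGroup.eq (s := (Gamma1 F n).comap (G1 F n).subtype)

lemma toX1_mul_of_mem {g u : G1 F n} (hu : u.1 ∈ Gamma1 F n) : toX1 (g * u) = toX1 g := by
  rw [eq_comm, toX1_eq_iff, Subgroup.coe_mul, inv_mul_cancel_left]
  exact hu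

lemma isOpenQuotientMap_toX1 : IsOpenQuotientMap (toX1 (F := F) (n := n)) :=
  QuotientGroup.isOpenQuotientMap_mk (N := (Gamma1 F n).comap (G1 F n).subtype)

instance : T2Space (X1 F n) := by
  refine (t2Space_iff_of_isOpenQuotientMap isOpenQuotientMap_toX1).2 ?_
  have : {q : G1 F n × G1 F n | toX1 q.1 = toX1 q.2} =
      (fun q : G1 F n × G1 F n => (q.1⁻¹ * q.2).1) ⁻¹' (Gamma1 F n) := by
    ext q
    exact toX1_eq_iff
  rw [this]
  exact isClosed_Gamma1.preimage (continuous_subtype_val.comp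
    (continuous_fst.inv.mul continuous_snd))

lemma continuous_orbitMap (g : G1 F n) : Continuous (orbitMap F n g) :=
  isOpenQuotientMap_toX1.continuous.comp (continuous_subtype_val.mul continuous_const)

lemma exists_subset_toX1_image {C : Set (X1 F n)} (hC : IsCompact C) :
    ∃ m : ℕ, C ⊆ toX1 '' {g : G1 F n | g.1 ∈ unitBall F n m} := by
  refine hC.elim_directed_cover _ (fun m => ?_) (fun x _ => ?_) ?_
  · exact isOpenQuotientMap_toX1.isOpenMap _
      ((isClopen_unitBall (m : ℤ)).isOpen.preimage continuous_subtype_val)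
  · obtain ⟨g, rfl⟩ := isOpenQuotientMap_toX1.surjective x
    obtain ⟨m, hm⟩ := exists_mem_unitBall g.1
    exact Set.mem_iUnion.2 ⟨m, g, hm, rfl⟩
  · exact Monotone.directed_le fun m m' h =>
      Set.image_mono fun g hg => unitBall_mono (by exact_mod_cast h) hg

lemma exists_subset_unitBall {P : Set (A1 F n)} (hP : IsCompact P) :
    ∃ m : ℕ, P ⊆ {a : A1 F n | a.1.1 ∈ unitBall F n m} := by
  refine hP.elim_directed_cover _ (fun m => ?_) (fun a _ => ?_) ?_
  · exact (isClopen_unitBall (m : ℤ)).isOpen.preimage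
      (continuous_subtype_val.comp continuous_subtype_val)
  · obtain ⟨m, hm⟩ := exists_mem_unitBall a.1.1
    exact Set.mem_iUnion.2 ⟨m, hm⟩
  · exact Monotone.directed_le fun m m' h => fun a ha => unitBall_mono (by exact_mod_cast h) ha

end

end Topology

section Equivalences

open Matrix

variable {F : Type} [Field F] {n : ℕ}

lemma eq_diagonal_of_isDiag {a : Matrix (Fin n) (Fin n) (Kv F)} (ha : a.IsDiag)
    (hu : IsUnit a) : ∃ α : Fin n → Kv F, (∀ i, α i ≠ 0) ∧ a = diagonal α := by
  refine ⟨a.diag, fun i => ?_, ha.diagonal_diag.symm⟩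
  have h := ((isUnit_iff_isUnit_det _).1 hu).ne_zero
  rw [← ha.diagonal_diag, det_diagonal] at h
  exact Finset.prod_ne_zero_iff.1 h i (Finset.mem_univ i)

lemma inv_eq_diagonal {a : GLn F n} {α : Fin n → Kv F} (hα : ∀ i, α i ≠ 0)
    (ha : a.1 = diagonal α) : a⁻¹.1 = diagonal fun i => (α i)⁻¹ := by
  refine Units.inv_eq_of_mul_eq_one_right (u := a) ?_
  rw [ha, diagonal_mul_diagonal]
  simp [hα]

lemma order_prod {ι : Type*} {s : Finset ι} {f : ι → Kv F} (hf : ∀ i ∈ s, f i ≠ 0) :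
    (∏ i ∈ s, f i).order = ∑ i ∈ s, (f i).order := by
  induction s using Finset.induction_on with
  | empty => simp
  | insert a s ha ih =>
    rw [Finset.forall_mem_insert] at hf
    rw [Finset.prod_insert ha, Finset.sum_insert ha,
      HahnSeries.order_mul hf.1 (Finset.prod_ne_zero_iff.2 hf.2), ih hf.2]

lemma order_inv {x : Kv F} (hx : x ≠ 0) : (x⁻¹).order = -x.order := by
  have h := HahnSeries.order_mul hx (inv_ne_zero hx)
  rw [mul_inv_cancel₀ hx, HahnSeries.order_one] at h
  lia

/-- The lattice spanned by the columns of `G` meets every coordinate axis nontrivially. -/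
def MeetsAxes (G : Matrix (Fin n) (Fin n) (Kv F)) : Prop :=
  ∀ i, ∃ p : Fin n → F[X], p ≠ 0 ∧ ∀ j, j ≠ i → (G *ᵥ embVec p) j = 0

lemma mulVec_embVec_ne_zero {G : Matrix (Fin n) (Fin n) (Kv F)} (hG : G.det ≠ 0)
    {p : Fin n → F[X]} (hp : p ≠ 0) : G *ᵥ embVec p ≠ 0 :=
  fun h => hp (embVec_eq_zero.1 (eq_zero_of_mulVec_eq_zero hG h))

lemma MeetsAxes.exists_single {G : Matrix (Fin n) (Fin n) (Kv F)} (hG : G.det ≠ 0)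
    (h : MeetsAxes G) : ∃ (p : Fin n → Fin n → F[X]) (c : Fin n → Kv F), ∀ i, p i ≠ 0 ∧ c i ≠ 0 ∧
      G *ᵥ embVec (p i) = Pi.single i (c i) := by
  choose p hp hpz using h
  have hs (i : Fin n) : G *ᵥ embVec (p i) = Pi.single i ((G *ᵥ embVec (p i)) i) := by
    ext1 j
    rcases eq_or_ne j i with rfl | hj
    · simp
    · rw [hpz i j hj, Pi.single_eq_of_ne hj]
  refine ⟨p, fun i => (G *ᵥ embVec (p i)) i, fun i => ⟨hp i, fun h0 => ?_, hs i⟩⟩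
  refine mulVec_embVec_ne_zero hG (hp i) ?_
  rw [hs i]
  exact (congrArg _ h0).trans (Pi.single_zero i)

lemma meetsAxes_iff_exists_diagonal {G : Matrix (Fin n) (Fin n) (Kv F)} (hG : G.det ≠ 0) :
    MeetsAxes G ↔ ∃ a : Matrix (Fin n) (Fin n) (Kv F), a.IsDiag ∧ IsUnit a ∧
      ∃ N : Matrix (Fin n) (Fin n) F[X], a * G = embMat N := by
  constructor
  · intro h
    obtain ⟨p, c, hpc⟩ := h.exists_single hG
    set M : Matrix (Fin n) (Fin n) F[X] := of fun i j => p j i with hM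
    have hGM : G * embMat M = diagonal c := by
      ext1 i j
      refine (congrFun (hpc j).2.2 i).trans ?_
      rcases eq_or_ne i j with rfl | hij
      · simp
      · simp [hij]
    have hdet : polyEmb F M.det ≠ 0 := by
      intro h0
      have := congrArg det hGM
      rw [det_mul, ← RingHom.map_det, h0, mul_zero, det_diagonal] at this
      exact Finset.prod_ne_zero_iff.2 (fun i _ => (hpc i).2.1) this.symm
    refine ⟨diagonal fun i => polyEmb F M.det * (c i)⁻¹, isDiag_diagonal _, ?_, M.adjugate, ?_⟩
    · rw [isUnit_iff_isUnit_det, det_diagonal, isUnit_iff_ne_zero]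
      exact Finset.prod_ne_zero_iff.2 fun i _ => mul_ne_zero hdet (inv_ne_zero (hpc i).2.1)
    · have h1 : diagonal c * embMat M.adjugate = polyEmb F M.det • G := by
        rw [← hGM, mul_assoc, ← map_mul, mul_adjugate, RingHom.mapMatrix_apply,
          Matrix.map_smul' _ _ _ (map_mul _)]
        simp
      have h2 : diagonal (fun i => (c i)⁻¹) * diagonal c = 1 := by
        simp [diagonal_mul_diagonal, fun i => (hpc i).2.1]
      rw [← one_mul (embMat _), ← h2, mul_assoc, h1]
      ext1 i j
      rw [diagonal_mul, diagonal_mul, Matrix.smul_apply, smul_eq_mul,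
        mul_comm (polyEmb F _), mul_assoc]
  · rintro ⟨a, ha, hu, N, hN⟩ i
    obtain ⟨α, hα, rfl⟩ := eq_diagonal_of_isDiag ha hu
    have hdet : N.det ≠ 0 := by
      intro h0
      have := congrArg det hN
      rw [det_mul, ← RingHom.map_det, h0, map_zero] at this
      exact mul_ne_zero ((isUnit_iff_isUnit_det _).1 hu).ne_zero hG this
    have hcol : N *ᵥ (N.adjugate *ᵥ Pi.single i 1) = Pi.single i N.det := by
      rw [mulVec_mulVec, mul_adjugate, smul_mulVec, one_mulVec, ← Pi.single_smul]
      simp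
    refine ⟨N.adjugate *ᵥ Pi.single i 1, fun h0 => ?_, fun j hj => ?_⟩
    · rw [h0, mulVec_zero] at hcol
      exact hdet (by simpa using (congrFun hcol i).symm)
    · have h1 := congrArg (fun A => (A *ᵥ embVec (N.adjugate *ᵥ Pi.single i 1)) j) hN
      simp only [embMat_mulVec, ← mulVec_mulVec, hcol, mulVec_diagonal] at h1
      rw [embVec, Pi.single_eq_of_ne hj, map_zero] at h1
      exact (mul_eq_zero.1 h1).resolve_left (hα j)

lemma forall_latticeSet_mem_RvN_iff {a G : Matrix (Fin n) (Fin n) (Kv F)} :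
    (∀ x ∈ latticeSet F n G, a *ᵥ x ∈ RvN F n) ↔
      ∃ N : Matrix (Fin n) (Fin n) F[X], a * G = embMat N := by
  constructor
  · intro h
    have hmem (i j : Fin n) : (a * G) i j ∈ Rv F := by
      have := h (G *ᵥ Pi.single j 1) ⟨Pi.single j 1, congrArg _ (funext fun k => ?_)⟩ i
      · rwa [mulVec_mulVec, mulVec_single_one] at this
      · rcases eq_or_ne k j with rfl | hk
        · simp
        · simp [hk]
    choose N hN using hmem
    exact ⟨of N, by ext1 i j; exact (hN i j).symm⟩
  · rintro ⟨N, hN⟩ x ⟨p, rfl⟩ i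
    rw [mulVec_mulVec, hN]
    exact ⟨(N *ᵥ p) i, (congrFun (embMat_mulVec N p) i).symm⟩

lemma single_mem_Ksub (m : ℤ) : (HahnSeries.single m 1 : Kv F) ∈ Ksub F := by
  have hneg (k : ℕ) : (HahnSeries.single (-(k : ℤ)) 1 : Kv F) ∈ Ksub F :=
    Subfield.subset_closure ⟨_, polyEmb_C_mul_X_pow 1 k⟩
  obtain ⟨k, rfl | rfl⟩ := m.eq_nat_or_neg
  · have := inv_mem (hneg k)
    rwa [HahnSeries.inv_single, neg_neg, inv_one] at this
  · exact hneg k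

lemma exists_denominator {ι : Type*} (s : Finset ι) {f : ι → Kv F} (hf : ∀ i, f i ∈ Ksub F) :
    ∃ d : F[X], d ≠ 0 ∧ ∀ i ∈ s, polyEmb F d * f i ∈ Rv F := by
  induction s using Finset.induction_on with
  | empty => exact ⟨1, one_ne_zero, by simp⟩
  | insert a s ha ih =>
    obtain ⟨d, hd, h⟩ := ih
    obtain ⟨y, hy, z, hz, hyz⟩ := Subfield.mem_closure_iff.1 (hf a)
    rw [Subring.closure_eq] at hy hz
    obtain ⟨e, rfl⟩ := hz
    rcases eq_or_ne e 0 with rfl | he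
    · rw [map_zero, div_zero] at hyz
      refine ⟨d, hd, Finset.forall_mem_insert _ _ _ |>.2 ⟨?_, h⟩⟩
      rw [← hyz, mul_zero]
      exact zero_mem _
    · have he' : polyEmb F e ≠ 0 := (map_ne_zero_iff _ polyEmb_injective).2 he
      refine ⟨d * e, mul_ne_zero hd he, Finset.forall_mem_insert _ _ _ |>.2 ⟨?_, fun i hi => ?_⟩⟩
      · rw [← hyz, map_mul, mul_assoc, mul_div_cancel₀ _ he']
        exact mul_mem ⟨d, rfl⟩ hy
      · rw [mul_comm d, map_mul, mul_assoc]
        exact mul_mem ⟨e, rfl⟩ (h i hi)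

lemma exists_diagonal_iff_exists_rational [Fintype F] (hn : 0 < n) (g : G1 F n) :
    (∃ a : Matrix (Fin n) (Fin n) (Kv F), a.IsDiag ∧ IsUnit a ∧
      ∀ x ∈ latticeSet F n (matOfG1 F n g), a *ᵥ x ∈ RvN F n) ↔
    ∃ a : GLn F n, a ∈ G1 F n ∧ (a : Matrix (Fin n) (Fin n) (Kv F)).IsDiag ∧
      ∃ h : Matrix (Fin n) (Fin n) (Kv F), IsUnit h ∧ (∀ i j, h i j ∈ Ksub F) ∧
        absv F h.det = 1 ∧ latticeSet F n (matOfG1 F n g) =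
          latticeSet F n ((a : Matrix (Fin n) (Fin n) (Kv F)) * h) := by
  constructor
  · rintro ⟨a, ha, hu, hN⟩
    obtain ⟨N, hN⟩ := forall_latticeSet_mem_RvN_iff.1 hN
    have hdet := ((isUnit_iff_isUnit_det _).1 hu).ne_zero
    obtain ⟨α, hα, hαa⟩ := eq_diagonal_of_isDiag ha hu
    set k : Fin n → ℤ := Pi.single ⟨0, hn⟩ a.det.order with hk
    have hb0 : (scale k * a).det ≠ 0 ∧ (scale k * a).det.order = 0 := by
      have h1 : (HahnSeries.single (-∑ i, k i) 1 : Kv F) ≠ 0 :=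
        HahnSeries.single_ne_zero one_ne_zero
      rw [det_mul, det_scale]
      refine ⟨mul_ne_zero h1 hdet, ?_⟩
      rw [HahnSeries.order_mul h1 hdet, HahnSeries.order_single one_ne_zero]
      simp [hk]
    obtain ⟨b, hb⟩ := (isUnit_iff_isUnit_det _).2 hb0.1.isUnit
    have hbG : b ∈ G1 F n := by
      refine absv_eq_one_iff.2 ?_
      rwa [hb]
    have hbdiag : b.1 = diagonal fun i => HahnSeries.single (-k i) 1 * α i := by
      rw [hb, hαa, scale, diagonal_mul_diagonal]
    refine ⟨b⁻¹, inv_mem hbG, ?_, b.1 * matOfG1 F n g, ?_, fun i j => ?_, ?_, ?_⟩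
    · rw [inv_eq_diagonal (fun i => mul_ne_zero (HahnSeries.single_ne_zero one_ne_zero) (hα i))
        hbdiag]
      exact isDiag_diagonal _
    · exact b.isUnit.mul g.1.isUnit
    · rw [hb, mul_assoc, hN, scale, diagonal_mul]
      exact mul_mem (single_mem_Ksub _) (Subfield.subset_closure ⟨N i j, rfl⟩)
    · exact mul_mem hbG g.2
    · rw [← mul_assoc, Units.inv_mul, one_mul]
  · rintro ⟨a, -, ha, h, -, hK, -, hlat⟩
    obtain ⟨α, hα, hαa⟩ := eq_diagonal_of_isDiag ha a.isUnit
    obtain ⟨d, hd, hdh⟩ := exists_denominator (f := fun q : Fin n × Fin n => h q.1 q.2)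
      Finset.univ fun q => hK q.1 q.2
    have hd' : polyEmb F d ≠ 0 := (map_ne_zero_iff _ polyEmb_injective).2 hd
    choose N hN using fun i j => hdh (i, j) (Finset.mem_univ _)
    refine ⟨diagonal (fun _ => polyEmb F d) * a⁻¹.1, ?_, ?_, ?_⟩
    · rw [inv_eq_diagonal hα hαa, diagonal_mul_diagonal]
      exact isDiag_diagonal _
    · refine IsUnit.mul ?_ a⁻¹.isUnit
      rw [isUnit_iff_isUnit_det, det_diagonal, isUnit_iff_ne_zero]
      exact Finset.prod_ne_zero_iff.2 fun _ _ => hd'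
    · rw [hlat]
      refine forall_latticeSet_mem_RvN_iff.2 ⟨of N, ?_⟩
      rw [mul_assoc, ← mul_assoc a⁻¹.1, Units.inv_mul, one_mul]
      ext1 i j
      rw [diagonal_mul]
      exact (hN i j).symm

lemma meetsAxes_iff_forall_exists {G : Matrix (Fin n) (Fin n) (Kv F)} (hG : G.det ≠ 0) :
    MeetsAxes G ↔ ∀ i : Fin n, ∃ x ∈ latticeSet F n G, x ≠ 0 ∧ ∀ j, j ≠ i → x j = 0 := by
  refine forall_congr' fun i => ⟨?_, ?_⟩
  · rintro ⟨p, hp, h⟩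
    exact ⟨_, ⟨p, rfl⟩, mulVec_embVec_ne_zero hG hp, h⟩
  · rintro ⟨_, ⟨p, rfl⟩, hx, h⟩
    exact ⟨p, fun hp => hx ((congrArg _ (embVec_eq_zero.2 hp)).trans (mulVec_zero G)), h⟩

lemma exists_eq_mul_of_toX1_eq [Fintype F] {g u : G1 F n}
    (h : toX1 u = toX1 g) :
    ∃ γ : (Matrix (Fin n) (Fin n) F[X])ˣ, g.1.1 = u.1.1 * embMat γ.1 := by
  have hmem : u.1⁻¹ * g.1 ∈ Gamma1 F n := toX1_eq_iff.1 h
  obtain ⟨γ, hγ⟩ := mem_Gamma1_iff.1 hmem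
  refine ⟨γ, ?_⟩
  rw [← hγ, ← Units.val_mul, mul_inv_cancel_left]

lemma order_le_of_toX1_eq [Fintype F] {g u : G1 F n} {m : ℤ} (hu : u.1 ∈ unitBall F n m)
    (h : toX1 u = toX1 g) {p : Fin n → F[X]} (hp : p ≠ 0)
    {i : Fin n} {c : Kv F} (hc : g.1.1 *ᵥ embVec p = Pi.single i c) : c.order ≤ m := by
  obtain ⟨γ, hγ⟩ := exists_eq_mul_of_toX1_eq h
  have hγp : γ.1 *ᵥ p ≠ 0 := fun h0 => hp <| by
    rw [← one_mulVec p, ← Units.inv_mul γ, ← mulVec_mulVec, h0, mulVec_zero]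
  have hval : embVec (γ.1 *ᵥ p) = u.1⁻¹.1 *ᵥ Pi.single i c := by
    rw [← hc, hγ, ← embMat_mulVec, mulVec_mulVec, ← mul_assoc, Units.inv_mul, one_mul]
  obtain ⟨j, hj⟩ := Function.ne_iff.1 hγp
  have hdeg : DegLE (polyEmb F ((γ.1 *ᵥ p) j)) (m + -c.order) := by
    have h1 : polyEmb F ((γ.1 *ᵥ p) j) = _ := congrFun hval j
    rw [mulVec_single, Pi.smul_apply, MulOpposite.smul_eq_mul_unop] at h1
    rw [h1]
    exact (hu j i).2.mul (DegLE.neg_order c)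
  have := nonneg_of_degLE_polyEmb hj hdeg
  lia

lemma mem_unitBall_of_order_le [Fintype F] {a : GLn F n} (ha : a ∈ G1 F n) (hdiag : a.1.IsDiag)
    {L : ℕ} (hL : ∀ i, (a.1 i i).order ≤ L) : a ∈ unitBall F n (n * L) := by
  obtain ⟨α, hα, haα⟩ := eq_diagonal_of_isDiag hdiag a.isUnit
  have hsum : ∑ i, (α i).order = 0 := by
    have h := (absv_eq_one_iff.1 ha).2
    rwa [haα, det_diagonal, order_prod fun i _ => hα i] at h
  have hL' (i : Fin n) : (α i).order ≤ L := by simpa [haα] using hL i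
  have hlow (i : Fin n) : -(n * L : ℤ) ≤ (α i).order := by
    have h1 := Finset.sum_le_sum fun j (_ : j ∈ Finset.univ.erase i) => hL' j
    have h2 := Finset.add_sum_erase Finset.univ (fun i => (α i).order) (Finset.mem_univ i)
    rw [Finset.sum_const, Finset.card_erase_of_mem (Finset.mem_univ i), Finset.card_univ,
      Fintype.card_fin, nsmul_eq_mul] at h1
    have h3 : ((n - 1 : ℕ) : ℤ) * L ≤ n * L := by
      gcongr
      lia
    lia
  intro i j
  rw [haα, inv_eq_diagonal hα haα]
  rcases eq_or_ne i j with rfl | hij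
  · rw [diagonal_apply_eq, diagonal_apply_eq]
    have hn : (L : ℤ) ≤ n * L := by
      have : 1 ≤ n := by have := i.2; lia
      exact_mod_cast Nat.le_mul_of_pos_left L this
    refine ⟨(DegLE.neg_order _).mono (by linarith [hlow i]), (DegLE.neg_order _).mono ?_⟩
    rw [order_inv (hα i)]
    linarith [hL' i]
  · rw [diagonal_apply_ne _ hij, diagonal_apply_ne _ hij]
    exact ⟨DegLE.zero _, DegLE.zero _⟩

/-- If the lattice meets every coordinate axis nontrivially, its diagonal orbit is divergent. -/
lemma isCompact_preimage_orbitMap [Fintype F] {g : G1 F n} (h : MeetsAxes g.1.1)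
    {C : Set (X1 F n)} (hC : IsCompact C) : IsCompact (orbitMap F n g ⁻¹' C) := by
  have hdet := (absv_eq_one_iff.1 g.2).1
  obtain ⟨p, c, hpc⟩ := h.exists_single hdet
  obtain ⟨m, hm⟩ := exists_subset_toX1_image hC
  refine (isCompact_unitBall_A1 (n * (∑ i, (m - (c i).order).natAbs : ℕ))).of_isClosed_subset
    (hC.isClosed.preimage (continuous_orbitMap g)) fun a ha => ?_
  refine mem_unitBall_of_order_le a.1.2 a.2 fun i => ?_
  obtain ⟨u, hu, hug⟩ := hm ha
  obtain ⟨α, hα, haα⟩ := eq_diagonal_of_isDiag a.2 a.1.1.isUnit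
  have hsingle : (a.1 * g).1.1 *ᵥ embVec (p i) = Pi.single i (α i * c i) := by
    have h1 : (a.1 * g).1.1 = diagonal α * g.1.1 := congrArg (· * g.1.1) haα
    rw [h1, ← mulVec_mulVec, (hpc i).2.2, diagonal_mulVec_single]
  have hle := order_le_of_toX1_eq hu hug (hpc i).1 hsingle
  rw [HahnSeries.order_mul (hα i) (hpc i).2.1] at hle
  have hsum := Finset.single_le_sum (f := fun i => (m - (c i).order).natAbs)
    (fun _ _ => Nat.zero_le _) (Finset.mem_univ i)
  have haii : a.1.1.1 i i = α i := by rw [haα, diagonal_apply_eq]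
  rw [haii]
  lia

/-- A lattice of covolume one without very short vectors has a basis of bounded size. -/
lemma exists_mem_unitBall_of_not_short [Fintype F] {G : GLn F n} (hG : G ∈ G1 F n)
    (h : ¬ Short G.1 (-(n : ℤ) * n - 1)) :
    ∃ γ : (Matrix (Fin n) (Fin n) F[X])ˣ,
      G * Units.map (polyEmb F).mapMatrix.toMonoidHom γ ∈ unitBall F n (n * n * n) := by
  obtain ⟨hdet, hord⟩ := absv_eq_one_iff.1 hG
  obtain ⟨γ, μ, hred⟩ := exists_columnReduced hdet
  have hsum := hred.sum_eq_zero hdet hord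
  have hlow (j : Fin n) : -(n * n : ℤ) ≤ μ j := by
    by_contra! hlt
    exact h ((short_mul_iff γ).1 ((short_of_col hred.degLE j).mono (by lia)))
  have hup (j : Fin n) : μ j ≤ n * n * n := by
    have h1 := Finset.sum_le_sum fun i (_ : i ∈ Finset.univ.erase j) => hlow i
    have h2 := Finset.add_sum_erase Finset.univ μ (Finset.mem_univ j)
    rw [Finset.sum_const, Finset.card_erase_of_mem (Finset.mem_univ j), Finset.card_univ,
      Fintype.card_fin, nsmul_eq_mul] at h1
    have h3 : ((n - 1 : ℕ) : ℤ) * (n * n) ≤ n * (n * n) := by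
      gcongr
      lia
    linarith
  refine ⟨γ, fun i j => ⟨(hred.degLE i j).mono (hup j), ?_⟩⟩
  set B := G * Units.map (polyEmb F).mapMatrix.toMonoidHom γ with hB
  have h1 := hred.degLE_of_mulVec (x := B⁻¹.1 *ᵥ Pi.single j 1) (m := 0) (fun k => ?_) i
  · rw [mulVec_single_one] at h1
    refine h1.mono ?_
    have hn : (1 : ℤ) ≤ n := by have := i.2; lia
    nlinarith [hlow i]
  · have h2 : (G.1 * embMat γ.1) *ᵥ (B⁻¹.1 *ᵥ Pi.single j 1) = Pi.single j 1 := by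
      rw [mulVec_mulVec, show G.1 * embMat γ.1 = B.1 from rfl, Units.mul_inv, one_mulVec]
    rw [h2]
    rcases eq_or_ne k j with rfl | hk
    · simpa using DegLE.one
    · simpa [hk] using DegLE.zero 0

/-- The diagonal element with entries `Y ^ k i`. -/
def scaleUnit (F : Type) [Field F] {n : ℕ} (k : Fin n → ℤ) : GLn F n where
  val := scale k
  inv := scale (-k)
  val_inv := by rw [← scale_add, add_neg_cancel, scale_zero]
  inv_val := by rw [← scale_add, neg_add_cancel, scale_zero]

/-- If the diagonal orbit is divergent, the lattice meets every coordinate axis nontrivially. -/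
lemma meetsAxes_of_isCompact_preimage [Fintype F] {g : G1 F n}
    (h : ∀ C : Set (X1 F n), IsCompact C → IsCompact (orbitMap F n g ⁻¹' C)) :
    MeetsAxes g.1.1 := by
  intro i₁
  obtain ⟨hdet, hord⟩ := absv_eq_one_iff.1 g.2
  obtain ⟨M, hM⟩ := exists_subset_unitBall
    (h _ ((isCompact_unitBall_G1 (n * n * n)).image isOpenQuotientMap_toX1.continuous))
  refine exists_axis_vector hdet hord (M := M + 1) fun k hk hki => ?_
  by_contra hshort
  have hmem : scaleUnit F k ∈ G1 F n := by
    refine absv_eq_one_iff.2 ?_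
    change (scale k).det ≠ 0 ∧ (scale k).det.order = 0
    rw [det_scale, hk]
    simp
  obtain ⟨a, ha⟩ : ∃ a : A1 F n, a.1.1 = scaleUnit F k :=
    ⟨⟨⟨scaleUnit F k, hmem⟩, isDiag_diagonal _⟩, rfl⟩
  obtain ⟨γ, hγ⟩ := exists_mem_unitBall_of_not_short (mul_mem hmem g.2) hshort
  obtain ⟨u, hu⟩ : ∃ u : G1 F n, u.1 = Units.map (polyEmb F).mapMatrix.toMonoidHom γ :=
    ⟨⟨_, absv_eq_one_iff.2 (det_embMat_unit γ)⟩, rfl⟩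
  have haP : orbitMap F n g a ∈ toX1 '' {g : G1 F n | g.1 ∈ unitBall F n (n * n * n)} := by
    refine ⟨a.1 * g * u, ?_, toX1_mul_of_mem (hu ▸ mem_Gamma1_iff.2 ⟨γ, rfl⟩)⟩
    rw [Set.mem_ofPred_eq, Subgroup.coe_mul, Subgroup.coe_mul, ha, hu]
    exact hγ
  have h1 := (hM haP i₁ i₁).2
  rw [ha] at h1
  change DegLE (scale (-k) i₁ i₁ : Kv F) M at h1
  rw [scale, diagonal_apply_eq] at h1
  have h2 := h1.neg_le_order (HahnSeries.single_ne_zero one_ne_zero)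
  rw [HahnSeries.order_single one_ne_zero] at h2
  simp only [Pi.neg_apply] at h2
  lia

end Equivalences

/-- **Characterization of divergent diagonal orbits** (Corollary 3.5 of the paper,
in the case `K = F_q(Y)`, `v = v_∞`): for `g ∈ G₁ = GL_n^1(K_v)`, the following are
equivalent: (1) the orbit map `A₁ → X₁ = G₁/Γ₁`, `a ↦ a g Γ₁` is proper;
(2) `g R_v^n = a h R_v^n` for some diagonal `a ∈ A₁` and some `h ∈ GL_n(K)` with
`|det h| = 1`; (3) some invertible diagonal matrix maps `g R_v^n` into `R_v^n`;
(4) `g R_v^n` meets every coordinate line nontrivially. -/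
theorem divergent_diagonal_orbit_characterization (n : ℕ) (hn : 2 ≤ n) (g : G1 Fq n) :
    ((∀ C : Set (X1 Fq n), IsCompact C → IsCompact (orbitMap Fq n g ⁻¹' C)) ↔
      (∃ a : GLn Fq n, a ∈ G1 Fq n ∧
        ((a : Matrix (Fin n) (Fin n) (Kv Fq)).IsDiag) ∧
        ∃ h : Matrix (Fin n) (Fin n) (Kv Fq), IsUnit h ∧ (∀ i j, h i j ∈ Ksub Fq) ∧
          absv Fq h.det = 1 ∧
          latticeSet Fq n (matOfG1 Fq n g) =
            latticeSet Fq n ((a : Matrix (Fin n) (Fin n) (Kv Fq)) * h))) ∧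
    ((∀ C : Set (X1 Fq n), IsCompact C → IsCompact (orbitMap Fq n g ⁻¹' C)) ↔
      (∃ a : Matrix (Fin n) (Fin n) (Kv Fq), a.IsDiag ∧ IsUnit a ∧
        ∀ x ∈ latticeSet Fq n (matOfG1 Fq n g), a.mulVec x ∈ RvN Fq n)) ∧
    ((∀ C : Set (X1 Fq n), IsCompact C → IsCompact (orbitMap Fq n g ⁻¹' C)) ↔
      (∀ i : Fin n, ∃ x ∈ latticeSet Fq n (matOfG1 Fq n g),
        x ≠ 0 ∧ ∀ j, j ≠ i → x j = 0)) := by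
  have h14 : (∀ C : Set (X1 Fq n), IsCompact C → IsCompact (orbitMap Fq n g ⁻¹' C)) ↔
      MeetsAxes g.1.1 :=
    ⟨meetsAxes_of_isCompact_preimage, fun h _ => isCompact_preimage_orbitMap h⟩
  have hdet : g.1.1.det ≠ 0 := (absv_eq_one_iff.1 g.2).1
  have h13 : (∀ C : Set (X1 Fq n), IsCompact C → IsCompact (orbitMap Fq n g ⁻¹' C)) ↔
      ∃ a : Matrix (Fin n) (Fin n) (Kv Fq), a.IsDiag ∧ IsUnit a ∧
        ∀ x ∈ latticeSet Fq n (matOfG1 Fq n g), a.mulVec x ∈ RvN Fq n := by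
    simp only [forall_latticeSet_mem_RvN_iff]
    exact h14.trans (meetsAxes_iff_exists_diagonal hdet)
  exact ⟨h13.trans (exists_diagonal_iff_exists_rational (by lia) g), h13,
    h14.trans (meetsAxes_iff_forall_exists hdet)⟩
end
end

section
/- There exist a real number c > 1, a bounded open neighborhood W of 0 in K_v^n, and a finite subset F of D = {diag(π^{−k_1},…,π^{−k_n}) : k ∈ ℤ^n, k_1+…+k_n = 0} ⊆ SL_n(K_v), such that for every g ∈ GL_n(K_v) with 1 ≤ |det g| ≤ q^n, there exists f ∈ F with ‖f w‖ ≥ c‖w‖ for every w ∈ (g R_v^n) ∩ W. -/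
noncomputable section

open Polynomial
open scoped Classical

variable (Fq : Type) [Field Fq] [Fintype Fq]

variable (n : ℕ)

/-- The subgroup `D = {diag(π^{-k_1},…,π^{-k_n}) : k ∈ ℤ^n, Σ k_i = 0} ⊆ SL_n(K_v)`,
as a set of matrices. -/
def Dset : Set (Matrix (Fin n) (Fin n) (Kv Fq)) :=
  {A | ∃ k : Fin n → ℤ, (∑ i, k i) = 0 ∧ A = Matrix.diagonal fun i => piv Fq ^ (-(k i))}

lemma one_lt_card_real : (1 : ℝ) < Fintype.card Fq := by
  exact_mod_cast Fintype.one_lt_card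

lemma absv_pos {x : Kv Fq} (hx : x ≠ 0) : 0 < absv Fq x := by
  rw [absv, if_neg hx]
  exact zpow_pos (zero_lt_one.trans (one_lt_card_real Fq)) _

lemma absv_nonneg (x : Kv Fq) : 0 ≤ absv Fq x := by
  rcases eq_or_ne x 0 with rfl | hx
  · exact (absv_zero Fq).ge
  · exact (absv_pos Fq hx).le

lemma isNonarchimedean_absv : IsNonarchimedean (absv Fq) := by
  intro x y
  rcases eq_or_ne x 0 with rfl | hx
  · simp
  rcases eq_or_ne y 0 with rfl | hy
  · simp
  rcases eq_or_ne (x + y) 0 with hxy | hxy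
  · rw [hxy, absv_zero]
    exact le_max_of_le_left (absv_pos Fq hx).le
  rw [absv, absv, absv, if_neg hxy, if_neg hx, if_neg hy,
    ← (zpow_right_mono₀ (one_lt_card_real Fq).le).map_max]
  apply zpow_le_zpow_right₀ (one_lt_card_real Fq).le
  have := HahnSeries.min_order_le_order_add hxy
  grind

/-- `absv` bundled as an absolute value. -/
def absvHom : AbsoluteValue (Kv Fq) ℝ where
  toFun := absv Fq
  map_mul' := absv_mul Fq
  nonneg' := absv_nonneg Fq
  eq_zero' _ := ⟨fun h ↦ by_contra fun hx ↦ (absv_pos Fq hx).ne' h, fun h ↦ h ▸ absv_zero Fq⟩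
  add_le' _ _ := (isNonarchimedean_absv Fq).add_le (absv_nonneg Fq)

lemma absv_piv_zpow (m : ℤ) : absv Fq (piv Fq ^ m) = (Fintype.card Fq : ℝ) ^ (-m) := by
  have h : absv Fq (piv Fq) = (Fintype.card Fq : ℝ)⁻¹ := by
    rw [absv, piv, if_neg (HahnSeries.single_ne_zero one_ne_zero),
      HahnSeries.order_single one_ne_zero, zpow_neg_one]
  rw [← inv_zpow', ← h]
  exact map_zpow₀ (absvHom Fq) _ _

set_option linter.unusedSectionVars false in
lemma coeff_polyEmb_s2 (p : Polynomial Fq) (d : ℕ) :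
    (polyEmb Fq p).coeff (-(d : ℤ)) = p.coeff d := by
  induction p using Polynomial.induction_on' with
  | add p q hp hq => simp [hp, hq]
  | monomial k a =>
    have : polyEmb Fq (monomial k a) = HahnSeries.single (-(k : ℤ)) a := by
      simp [polyEmb, Yv, HahnSeries.single_pow, HahnSeries.C_apply]
    rw [this, HahnSeries.coeff_single, coeff_monomial]
    grind

lemma one_le_absv_polyEmb {p : Polynomial Fq} (hp : polyEmb Fq p ≠ 0) :
    1 ≤ absv Fq (polyEmb Fq p) := by
  have hp0 : p ≠ 0 := fun h ↦ hp (by simp [h])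
  have h : (polyEmb Fq p).order ≤ -(p.natDegree : ℤ) :=
    HahnSeries.order_le_of_coeff_ne_zero (by simpa [coeff_polyEmb_s2] using hp0)
  rw [absv, if_neg hp]
  exact one_le_zpow₀ (one_lt_card_real Fq).le (by omega)

lemma absv_sum_lt {ι : Type*} (s : Finset ι) (f : ι → Kv Fq) {r : ℝ} (hr : 0 < r)
    (h : ∀ i ∈ s, absv Fq (f i) < r) : absv Fq (∑ i ∈ s, f i) < r := by
  rcases s.eq_empty_or_nonempty with rfl | hs
  · simpa [absv_zero] using hr
  obtain ⟨i, hi, hle⟩ := (isNonarchimedean_absv Fq).finset_image_add_of_nonempty f hs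
  exact hle.trans_lt (h i hi)

lemma absv_det_lt_one {n : ℕ} (hn : n ≠ 0) (M : Matrix (Fin n) (Fin n) (Kv Fq))
    (h : ∀ i j, absv Fq (M i j) < 1) : absv Fq M.det < 1 := by
  have := NeZero.mk hn
  rw [Matrix.det_apply]
  refine absv_sum_lt Fq _ _ one_pos fun σ _ ↦ ?_
  have hs : absv Fq (Equiv.Perm.sign σ • ∏ i, M (σ i) i) = ∏ i, absv Fq (M (σ i) i) := by
    change absvHom Fq _ = ∏ i, absvHom Fq (M (σ i) i)
    rcases Int.units_eq_one_or (Equiv.Perm.sign σ) with h | h <;> simp [h, map_prod]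
  rw [hs, ← Finset.mul_prod_erase _ _ (Finset.mem_univ (0 : Fin n))]
  refine mul_lt_one_of_nonneg_of_lt_one_left (absv_nonneg Fq _) (h _ _) ?_
  exact Finset.prod_le_one (fun _ _ ↦ absv_nonneg Fq _) fun _ _ ↦ (h _ _).le

lemma absv_lt_one_iff (x : Kv Fq) :
    absv Fq x < 1 ↔ Valued.v x < (1 : WithZero (Multiplicative ℤ)) := by
  rcases eq_or_ne x 0 with rfl | hx
  · simp [absv_zero]
  have hv := LaurentSeries.valuation_le_iff_coeff_lt_eq_zero Fq (D := 1) (f := x)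
  have hlt : Valued.v x < (1 : WithZero (Multiplicative ℤ)) ↔
      Valued.v x ≤ WithZero.exp (-1 : ℤ) := by
    have hx0 : Valued.v x ≠ (0 : WithZero (Multiplicative ℤ)) := (Valuation.ne_zero_iff _).mpr hx
    rw [← WithZero.exp_log hx0, ← WithZero.exp_zero,
      WithZero.exp_lt_exp, WithZero.exp_le_exp]
    omega
  rw [hlt, hv, absv, if_neg hx, zpow_lt_one_iff_right₀ (one_lt_card_real Fq)]
  refine ⟨fun h m hm ↦ HahnSeries.coeff_eq_zero_of_lt_order (by omega), fun h ↦ ?_⟩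
  by_contra hx'
  exact hx (HahnSeries.coeff_order_eq_zero.mp (h _ (by omega)))

lemma isOpen_absv_lt_one : IsOpen {x : Kv Fq | absv Fq x < 1} := by
  simp_rw [absv_lt_one_iff]
  simpa using Valued.isOpen_ball (Kv Fq) (Γ₀ := WithZero (Multiplicative ℤ)) 1

/-- The elements of norm less than `1` of a lattice of covolume at least `1` do not span. -/
lemma span_ne_top_of_one_le_absv_det {n : ℕ} (hn : n ≠ 0)
    (g : Matrix (Fin n) (Fin n) (Kv Fq)) (hg : 1 ≤ absv Fq g.det)
    (s : Set (Fin n → Kv Fq)) (hs : s ⊆ latticeSet Fq n g)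
    (hlt : ∀ w ∈ s, ∀ i, absv Fq (w i) < 1) : Submodule.span (Kv Fq) s ≠ ⊤ := by
  intro htop
  obtain ⟨b, hbs, -, hli⟩ := Submodule.exists_fun_fin_finrank_span_eq (Kv Fq) s
  have hfr : Module.finrank (Kv Fq) (Submodule.span (Kv Fq) s) = n := by
    rw [htop, finrank_top, Module.finrank_fin_fun]
  choose p hp using fun i : Fin n ↦ hs (hbs (Fin.cast hfr.symm i))
  set B : Matrix (Fin n) (Fin n) (Kv Fq) := Matrix.of fun i ↦ b (Fin.cast hfr.symm i)
  have hBu : IsUnit B :=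
    Matrix.linearIndependent_rows_iff_isUnit.mp (hli.comp _ (Fin.cast_injective hfr.symm))
  have hBdet : B.det ≠ 0 := ((Matrix.isUnit_iff_isUnit_det B).mp hBu).ne_zero
  have hmul : B.transpose = g * ((Matrix.of p).transpose.map (polyEmb Fq)) :=
    Matrix.ext fun i j ↦ congrFun (hp j) i
  have hdet : B.det = g.det * polyEmb Fq (Matrix.of p).det := by
    rw [← Matrix.det_transpose B, hmul, Matrix.det_mul, ← Matrix.det_transpose (Matrix.of p),
      RingHom.map_det]
    rfl
  have hle : 1 ≤ absv Fq B.det := by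
    have h0 : polyEmb Fq (Matrix.of p).det ≠ 0 := right_ne_zero_of_mul (hdet ▸ hBdet)
    rw [hdet, absv_mul]
    exact one_le_mul_of_one_le_of_one_le hg (one_le_absv_polyEmb Fq h0)
  exact hle.not_gt (absv_det_lt_one Fq hn B fun i j ↦ hlt _ (hbs _) j)

/-- A proper subspace is a graph over a coordinate hyperplane with coefficients of absolute value
at most one. -/
lemma exists_coord_dominated {n : ℕ} (V : Submodule (Kv Fq) (Fin n → Kv Fq)) (hV : V ≠ ⊤) :
    ∃ i, ∀ w ∈ V, w ≠ 0 → ∃ j ≠ i, ∀ k, absv Fq (w k) ≤ absv Fq (w j) := by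
  obtain ⟨f, hf0, hf⟩ := Submodule.exists_le_ker_of_lt_top V hV.lt_top
  set a : Fin n → Kv Fq := fun i ↦ f fun j ↦ if i = j then 1 else 0
  have hfa (x) : f x = ∑ i, x i * a i := f.pi_apply_eq_sum_univ x
  have hne : ∃ i, a i ≠ 0 := by
    by_contra! h
    exact hf0 (LinearMap.ext fun x ↦ by simp [hfa, h])
  obtain ⟨i₀, hi₀⟩ := hne
  obtain ⟨i, -, hi⟩ := Finset.exists_max_image Finset.univ (fun i ↦ absv Fq (a i)) ⟨i₀, by simp⟩
  have hai : 0 < absv Fq (a i) := (absv_pos Fq hi₀).trans_le (hi i₀ (by simp))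
  refine ⟨i, fun w hw hw0 ↦ ?_⟩
  obtain ⟨m, -, hm⟩ := Finset.exists_max_image Finset.univ (fun k ↦ absv Fq (w k)) ⟨i, by simp⟩
  by_contra! hcon
  have hmi : m = i := by
    by_contra hmi
    obtain ⟨k, hk⟩ := hcon m hmi
    exact hk.not_ge (hm k (by simp))
  subst hmi
  have hlt (j) (hj : j ≠ m) : absv Fq (w j) < absv Fq (w m) := by
    obtain ⟨k, hk⟩ := hcon j hj
    exact hk.trans_le (hm k (by simp))
  have hwm : 0 < absv Fq (w m) := by
    obtain ⟨k, hk⟩ := Function.ne_iff.mp hw0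
    exact (absv_pos Fq hk).trans_le (hm k (by simp))
  have hsum : ∑ i, w i * a i = 0 := by rw [← hfa]; exact hf hw
  rw [← Finset.add_sum_erase _ _ (Finset.mem_univ m)] at hsum
  have heq : absv Fq (w m * a m) = absv Fq (∑ j ∈ Finset.univ.erase m, w j * a j) := by
    rw [eq_neg_of_add_eq_zero_left hsum]
    exact (absvHom Fq).map_neg _
  refine heq.not_gt (absv_sum_lt Fq _ _ (absv_mul Fq _ _ ▸ mul_pos hwm hai) fun j hj ↦ ?_)
  rw [absv_mul, absv_mul]
  exact (mul_le_mul_of_nonneg_left (hi j (by simp)) (absv_nonneg Fq _)).trans_lt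
    (mul_lt_mul_of_pos_right (hlt j (Finset.ne_of_mem_erase hj)) hai)

lemma absv_le_vnorm {n : ℕ} (w : Fin n → Kv Fq) (i : Fin n) : absv Fq (w i) ≤ vnorm Fq n w :=
  le_ciSup (Set.finite_range fun i ↦ absv Fq (w i)).bddAbove i

/-- The exponents of the diagonal matrix of determinant one that contracts the `i`-th coordinate
and expands all the others by `q`. -/
def expandExponent (n : ℕ) (i : Fin n) : Fin n → ℤ := fun j ↦ 1 - if j = i then (n : ℤ) else 0

lemma sum_expandExponent (n : ℕ) (i : Fin n) : ∑ j, expandExponent n i j = 0 := by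
  simp [expandExponent]

/-- **Lemma 3.2 of the paper** (for `K = F_q(Y)`, `v = v_∞`): there exist `c > 1`,
a bounded open neighborhood `W` of `0` in `K_v^n` and a finite subset `F` of `D`
such that for every `g ∈ GL_n(K_v)` with `1 ≤ |det g| ≤ q^n` there is `f ∈ F`
with `‖f w‖ ≥ c ‖w‖` for all `w ∈ (g R_v^n) ∩ W`. -/
theorem expansion_on_lattices_lemma (n : ℕ) (hn : 2 ≤ n) :
    ∃ c : ℝ, 1 < c ∧
    ∃ W : Set (Fin n → Kv Fq), IsOpen W ∧ (0 : Fin n → Kv Fq) ∈ W ∧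
      (∃ R : ℝ, ∀ x ∈ W, vnorm Fq n x ≤ R) ∧
      ∃ F : Finset (Matrix (Fin n) (Fin n) (Kv Fq)), ↑F ⊆ Dset Fq n ∧
        ∀ g : (Matrix (Fin n) (Fin n) (Kv Fq))ˣ,
          1 ≤ absv Fq ((g : Matrix (Fin n) (Fin n) (Kv Fq)).det) →
          absv Fq ((g : Matrix (Fin n) (Fin n) (Kv Fq)).det) ≤ (Fintype.card Fq : ℝ) ^ n →
          ∃ f ∈ F, ∀ w ∈ latticeSet Fq n ((g : Matrix (Fin n) (Fin n) (Kv Fq))) ∩ W,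
            c * vnorm Fq n w ≤ vnorm Fq n (f.mulVec w) := by
  have hn0 : n ≠ 0 := by omega
  have := NeZero.mk hn0
  have hq := one_lt_card_real Fq
  let f : Fin n → Matrix (Fin n) (Fin n) (Kv Fq) := fun i ↦
    Matrix.diagonal fun j ↦ piv Fq ^ (-(expandExponent n i j))
  refine ⟨Fintype.card Fq, hq, Set.univ.pi fun _ ↦ {x | absv Fq x < 1},
    isOpen_set_pi Set.finite_univ fun _ _ ↦ isOpen_absv_lt_one Fq, fun i _ ↦ by simp [absv_zero],
    ⟨1, fun x hx ↦ ciSup_le fun i ↦ (hx i trivial).le⟩, Finset.univ.image f, ?_, ?_⟩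
  · intro A hA
    obtain ⟨i, -, rfl⟩ := Finset.mem_image.mp (Finset.mem_coe.mp hA)
    exact ⟨_, sum_expandExponent n i, rfl⟩
  intro g hg _
  obtain ⟨i, hi⟩ := exists_coord_dominated Fq _ (span_ne_top_of_one_le_absv_det Fq hn0
    (g : Matrix (Fin n) (Fin n) (Kv Fq)) hg
    (latticeSet Fq n g ∩ Set.univ.pi fun _ ↦ {x | absv Fq x < 1}) Set.inter_subset_left
    fun w hw i ↦ hw.2 i trivial)
  refine ⟨f i, Finset.mem_image_of_mem _ (Finset.mem_univ i), fun w hw ↦ ?_⟩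
  rcases eq_or_ne w 0 with rfl | hw0
  · simp [vnorm, absv_zero]
  obtain ⟨j, hji, hj⟩ := hi w (Submodule.subset_span hw) hw0
  have hfj : absv Fq ((f i).mulVec w j) = Fintype.card Fq * absv Fq (w j) := by
    rw [Matrix.mulVec_diagonal, absv_mul, absv_piv_zpow]
    simp [expandExponent, hji]
  calc (Fintype.card Fq : ℝ) * vnorm Fq n w
      ≤ Fintype.card Fq * absv Fq (w j) := by
        gcongr
        exact ciSup_le hj
    _ = absv Fq ((f i).mulVec w j) := hfj.symm
    _ ≤ vnorm Fq n ((f i).mulVec w) := absv_le_vnorm Fq _ j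
end
end

section
/- Let N ≥ 0 and ℓ ≥ ℓ' ≥ 1 be integers and let S ⊆ B_{ℓ,N}. Then there exist an integer C with 0 ≤ C ≤ q^{ℓ' n²} and elements g_1,…,g_C ∈ S such that S ⊆ B_{ℓ+ℓ',N}·g_1 ∪ … ∪ B_{ℓ+ℓ',N}·g_C and the sets B_{ℓ+ℓ',N}·g_i, 1 ≤ i ≤ C, are pairwise disjoint. -/
noncomputable section

open Polynomial
open scoped Classical

variable (Fq : Type) [Field Fq] [Fintype Fq]

variable (n : ℕ)

variable [NeZero n]

/-- The dynamical neighborhood `W_{ℓ,N}` of `0` in `M_n(K_v)`: all entries in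
`π^ℓ O_v`, and the entries `w_{i,1}`, `i ≥ 2`, in `π^{ℓ+nN} O_v`. -/
def Wset (ℓ N : ℤ) : Set (Matrix (Fin n) (Fin n) (Kv Fq)) :=
  {w | (∀ i j, inPiPow Fq ℓ (w i j)) ∧ ∀ i, i ≠ 0 → inPiPow Fq (ℓ + n * N) (w i 0)}

/-- The dynamical ball `B_{ℓ,N} = (I_n + W_{ℓ,N}) ∩ SL_n(K_v)`. -/
def Bset (ℓ N : ℤ) : Set (Matrix (Fin n) (Fin n) (Kv Fq)) :=
  {b | b.det = 1 ∧ b - 1 ∈ Wset Fq n ℓ N}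

section InPiPow

omit [Fintype Fq]

variable {Fq}

lemma inPiPow_iff_coeff {k : ℤ} {x : Kv Fq} :
    inPiPow Fq k x ↔ ∀ m < k, x.coeff m = 0 := by
  rcases eq_or_ne x 0 with rfl | hx
  · simp [inPiPow]
  · simp only [inPiPow, hx, false_or]
    refine ⟨fun h m hm => HahnSeries.coeff_eq_zero_of_lt_order (hm.trans_le h), fun h => ?_⟩
    by_contra! hk
    exact hx (HahnSeries.coeff_order_eq_zero.mp (h _ hk))

lemma inPiPow.mono {k m : ℤ} (hkm : k ≤ m) {x : Kv Fq} (hx : inPiPow Fq m x) :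
    inPiPow Fq k x :=
  hx.imp_right hkm.trans

lemma inPiPow.add {k : ℤ} {x y : Kv Fq} (hx : inPiPow Fq k x) (hy : inPiPow Fq k y) :
    inPiPow Fq k (x + y) := by
  rw [inPiPow_iff_coeff] at *
  intro m hm
  rw [HahnSeries.coeff_add, hx m hm, hy m hm, add_zero]

lemma inPiPow.sub {k : ℤ} {x y : Kv Fq} (hx : inPiPow Fq k x) (hy : inPiPow Fq k y) :
    inPiPow Fq k (x - y) := by
  rw [inPiPow_iff_coeff] at *
  intro m hm
  rw [HahnSeries.coeff_sub, hx m hm, hy m hm, sub_zero]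

lemma inPiPow.mul {k m : ℤ} {x y : Kv Fq} (hx : inPiPow Fq k x) (hy : inPiPow Fq m y) :
    inPiPow Fq (k + m) (x * y) := by
  rcases eq_or_ne x 0 with rfl | hx0
  · exact Or.inl (zero_mul y)
  rcases eq_or_ne y 0 with rfl | hy0
  · exact Or.inl (mul_zero x)
  right
  rw [HahnSeries.order_mul hx0 hy0]
  exact add_le_add (hx.resolve_left hx0) (hy.resolve_left hy0)

lemma inPiPow_sum {ι : Type*} {k : ℤ} (s : Finset ι) (f : ι → Kv Fq)
    (hf : ∀ i ∈ s, inPiPow Fq k (f i)) : inPiPow Fq k (∑ i ∈ s, f i) :=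
  Finset.sum_induction f (inPiPow Fq k) (fun _ _ => inPiPow.add) (Or.inl rfl) hf

lemma eventually_inPiPow_sub (k : ℤ) (x : Kv Fq) :
    ∀ᶠ t : ℕ in Filter.atTop, inPiPow Fq (k - t) x := by
  filter_upwards [Filter.eventually_ge_atTop (k - x.order).toNat] with t ht
  exact Or.inr (by omega)

/-- Elements of `π^k O_v` agree modulo `π^(k+L) O_v` exactly when their coefficients of
degrees `k, …, k+L-1` do. -/
lemma inPiPow_sub_iff_coeff {k : ℤ} {x y : Kv Fq} (hxy : inPiPow Fq k (x - y)) (L : ℕ) :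
    inPiPow Fq (k + L) (x - y) ↔
      ∀ t : Fin L, x.coeff (k + (t : ℕ)) = y.coeff (k + (t : ℕ)) := by
  rw [inPiPow_iff_coeff] at *
  refine ⟨fun h t => ?_, fun h m hm => ?_⟩
  · rw [← sub_eq_zero, ← HahnSeries.coeff_sub]
    exact h _ (by omega)
  · rcases lt_or_ge m k with hk | hk
    · exact hxy m hk
    · have ht := h ⟨(m - k).toNat, by omega⟩
      rw [show k + ((m - k).toNat : ℤ) = m by omega] at ht
      rw [HahnSeries.coeff_sub, ht, sub_self]

end InPiPow

section Wset

omit [Fintype Fq]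

variable {Fq n}

/-- The extra order of vanishing required of the `(i, j)` entry of an element of `W_{ℓ,N}`. -/
def extraOrder (n : ℕ) [NeZero n] (N : ℤ) (i j : Fin n) : ℤ :=
  if i ≠ 0 ∧ j = 0 then n * N else 0

lemma extraOrder_le_add {N : ℤ} (hN : 0 ≤ N) (i j k : Fin n) :
    extraOrder n N i k ≤ extraOrder n N i j + extraOrder n N j k := by
  have h : 0 ≤ (n : ℤ) * N := by positivity
  unfold extraOrder
  split_ifs <;> omega

lemma mem_Wset_iff {N : ℤ} (hN : 0 ≤ N) {k : ℤ} {w : Matrix (Fin n) (Fin n) (Kv Fq)} :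
    w ∈ Wset Fq n k N ↔ ∀ i j, inPiPow Fq (k + extraOrder n N i j) (w i j) := by
  have h : 0 ≤ (n : ℤ) * N := by positivity
  constructor
  · rintro ⟨hw, hw0⟩ i j
    unfold extraOrder
    split_ifs with hij
    · rw [hij.2]
      exact hw0 i hij.1
    · rw [add_zero]
      exact hw i j
  · intro hw
    refine ⟨fun i j => (hw i j).mono ?_, fun i hi => ?_⟩
    · unfold extraOrder
      split_ifs <;> omega
    · simpa [extraOrder, hi] using hw i 0

lemma Wset_anti {N k m : ℤ} (hkm : k ≤ m) : Wset Fq n m N ⊆ Wset Fq n k N :=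
  fun _ hw => ⟨fun i j => (hw.1 i j).mono hkm,
    fun i hi => (hw.2 i hi).mono (by omega)⟩

lemma Wset_add_mem {N k : ℤ} {w u : Matrix (Fin n) (Fin n) (Kv Fq)}
    (hw : w ∈ Wset Fq n k N) (hu : u ∈ Wset Fq n k N) : w + u ∈ Wset Fq n k N :=
  ⟨fun i j => (hw.1 i j).add (hu.1 i j), fun i hi => (hw.2 i hi).add (hu.2 i hi)⟩

lemma Wset_sub_mem {N k : ℤ} {w u : Matrix (Fin n) (Fin n) (Kv Fq)}
    (hw : w ∈ Wset Fq n k N) (hu : u ∈ Wset Fq n k N) : w - u ∈ Wset Fq n k N :=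
  ⟨fun i j => (hw.1 i j).sub (hu.1 i j), fun i hi => (hw.2 i hi).sub (hu.2 i hi)⟩

lemma Wset_mul_mem {N : ℤ} (hN : 0 ≤ N) {k m : ℤ} {w u : Matrix (Fin n) (Fin n) (Kv Fq)}
    (hw : w ∈ Wset Fq n k N) (hu : u ∈ Wset Fq n m N) : w * u ∈ Wset Fq n (k + m) N := by
  rw [mem_Wset_iff hN] at *
  intro i j
  rw [Matrix.mul_apply]
  refine inPiPow_sum _ _ fun t _ => ((hw i t).mul (hu t j)).mono ?_
  linarith [extraOrder_le_add hN i t j]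

lemma exists_mem_Wset_sub {N : ℤ} (hN : 0 ≤ N) (k : ℤ) (u : Matrix (Fin n) (Fin n) (Kv Fq)) :
    ∃ t : ℕ, u ∈ Wset Fq n (k - t) N := by
  have h : ∀ᶠ t : ℕ in Filter.atTop,
      ∀ i j, inPiPow Fq (k + extraOrder n N i j - t) (u i j) :=
    Filter.eventually_all.mpr fun i => Filter.eventually_all.mpr fun j =>
      eventually_inPiPow_sub _ _
  obtain ⟨t, ht⟩ := h.exists
  refine ⟨t, (mem_Wset_iff hN).mpr fun i j => ?_⟩
  rw [sub_add_eq_add_sub]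
  exact ht i j

/-- Right multiplication by an element of `I_n + W_{ℓ,N}` preserves `W_{k,N}` in both
directions. -/
lemma mul_mem_Wset_iff {N : ℤ} (hN : 0 ≤ N) {ℓ : ℤ} (hℓ : 1 ≤ ℓ) (k : ℤ)
    {u h : Matrix (Fin n) (Fin n) (Kv Fq)} (hh : h - 1 ∈ Wset Fq n ℓ N) :
    u * h ∈ Wset Fq n k N ↔ u ∈ Wset Fq n k N := by
  constructor
  · intro huh
    obtain ⟨t, ht⟩ := exists_mem_Wset_sub hN k u
    induction t with
    | zero => simpa using ht
    | succ t ih =>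
      apply ih
      have hu : u = u * h - u * (h - 1) := by noncomm_ring
      rw [hu]
      exact Wset_sub_mem (Wset_anti (by omega) huh)
        (Wset_anti (by push_cast; omega) (Wset_mul_mem hN ht hh))
  · intro hu
    have huh : u * h = u + u * (h - 1) := by noncomm_ring
    rw [huh]
    exact Wset_add_mem hu (Wset_anti (by omega) (Wset_mul_mem hN hu hh))

/-- The coefficients of the entries of `g` which determine its class modulo `W_{ℓ+L,N}`
inside a class modulo `W_{ℓ,N}`. -/
def leadingCoeffs (ℓ N : ℤ) (L : ℕ) (g : Matrix (Fin n) (Fin n) (Kv Fq)) :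
    Fin n × Fin n × Fin L → Fq :=
  fun p => (g p.1 p.2.1).coeff (ℓ + extraOrder n N p.1 p.2.1 + (p.2.2 : ℕ))

lemma leadingCoeffs_eq_iff {N : ℤ} (hN : 0 ≤ N) {ℓ : ℤ} (L : ℕ)
    {g h : Matrix (Fin n) (Fin n) (Kv Fq)} (hgh : g - h ∈ Wset Fq n ℓ N) :
    leadingCoeffs ℓ N L g = leadingCoeffs ℓ N L h ↔ g - h ∈ Wset Fq n (ℓ + L) N := by
  rw [mem_Wset_iff hN] at *
  simp only [funext_iff, Prod.forall, leadingCoeffs]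
  refine forall₂_congr fun i j => ?_
  rw [add_right_comm]
  exact (inPiPow_sub_iff_coeff (hgh i j) L).symm

/-- Two elements of `B_{ℓ,N}` which are congruent modulo `W_{k,N}` lie in the same right
translate of `B_{k,N}`. -/
lemma mem_image_Bset_of_sub_mem {N : ℤ} (hN : 0 ≤ N) {ℓ : ℤ} (hℓ : 1 ≤ ℓ) {k : ℤ}
    {g h : Matrix (Fin n) (Fin n) (Kv Fq)} (hg : g ∈ Bset Fq n ℓ N) (hh : h ∈ Bset Fq n ℓ N)
    (hgh : g - h ∈ Wset Fq n k N) : g ∈ (fun b => b * h) '' Bset Fq n k N := by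
  have hdet : IsUnit h.det := by rw [hh.1]; exact isUnit_one
  have hmul : g * h⁻¹ * h = g := Matrix.nonsing_inv_mul_cancel_right h g hdet
  refine ⟨g * h⁻¹, ⟨?_, ?_⟩, hmul⟩
  · have := congrArg Matrix.det hmul
    rwa [Matrix.det_mul, hh.1, mul_one, hg.1] at this
  · rw [← mul_mem_Wset_iff hN hℓ k hh.2, sub_mul, one_mul, hmul]
    exact hgh

/-- If right translates of `B_{k,N}` by elements of `B_{ℓ,N}` meet, then these elements are
congruent modulo `W_{k,N}`. -/
lemma sub_mem_Wset_of_mul_eq_mul {N : ℤ} (hN : 0 ≤ N) {ℓ : ℤ} (hℓ : 1 ≤ ℓ) {k : ℤ}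
    {g h b c : Matrix (Fin n) (Fin n) (Kv Fq)} (hg : g ∈ Bset Fq n ℓ N)
    (hh : h ∈ Bset Fq n ℓ N) (hb : b ∈ Bset Fq n k N) (hc : c ∈ Bset Fq n k N)
    (hbc : b * g = c * h) : g - h ∈ Wset Fq n k N := by
  have hgh : g - h = (c - 1) * h - (b - 1) * g := by
    rw [sub_mul, sub_mul, hbc, one_mul, one_mul]
    abel
  rw [hgh]
  exact Wset_sub_mem ((mul_mem_Wset_iff hN hℓ k hh.2).mpr hc.2)
    ((mul_mem_Wset_iff hN hℓ k hg.2).mpr hb.2)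

end Wset

/-- **Lemma 6.5 of the paper**: any subset `S` of `B_{ℓ,N}` can be covered by at most
`q^{ℓ' n²}` pairwise disjoint balls `B_{ℓ+ℓ',N} g_i` with centers `g_i ∈ S`. -/
theorem cover_dynamical_balls (hn : 2 ≤ n) (N ℓ ℓ' : ℤ)
    (hN : 0 ≤ N) (hℓ' : 1 ≤ ℓ') (hℓ : ℓ' ≤ ℓ)
    (S : Set (Matrix (Fin n) (Fin n) (Kv Fq))) (hS : S ⊆ Bset Fq n ℓ N) :
    ∃ (C : ℕ) (g : Fin C → Matrix (Fin n) (Fin n) (Kv Fq)),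
      (C : ℝ) ≤ (Fintype.card Fq : ℝ) ^ (ℓ' * (n : ℤ) ^ 2) ∧
      (∀ i, g i ∈ S) ∧
      (S ⊆ ⋃ i, (fun b => b * g i) '' Bset Fq n (ℓ + ℓ') N) ∧
      (∀ i j, i ≠ j →
        Disjoint ((fun b => b * g i) '' Bset Fq n (ℓ + ℓ') N)
          ((fun b => b * g j) '' Bset Fq n (ℓ + ℓ') N)) := by
  obtain ⟨L, rfl⟩ := Int.eq_ofNat_of_zero_le (zero_le_one.trans hℓ')
  have hℓ1 : 1 ≤ ℓ := hℓ'.trans hℓ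
  have hsub : ∀ {g h}, g ∈ S → h ∈ S → g - h ∈ Wset Fq n ℓ N := fun {g h} hg hh => by
    rw [← sub_sub_sub_cancel_right g h 1]
    exact Wset_sub_mem (hS hg).2 (hS hh).2
  let T : Set (Fin n × Fin n × Fin L → Fq) := leadingCoeffs ℓ N L '' S
  choose r hrS hr using fun t : T => t.2
  let e := Fintype.equivFin T
  refine ⟨Fintype.card T, fun i => r (e.symm i), ?_, fun i => hrS _, fun s hs => ?_,
    fun i j hij => ?_⟩
  · have hcard : Fintype.card T ≤ Fintype.card Fq ^ (L * n ^ 2) := by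
      refine (set_fintype_card_le_univ T).trans_eq ?_
      simp only [Fintype.card_fun, Fintype.card_prod, Fintype.card_fin]
      congr 1
      ring
    exact_mod_cast hcard
  · have hsT : leadingCoeffs ℓ N L s ∈ T := Set.mem_image_of_mem _ hs
    refine Set.mem_iUnion.mpr ⟨e ⟨_, hsT⟩, ?_⟩
    simp only [e.symm_apply_apply]
    refine mem_image_Bset_of_sub_mem hN hℓ1 (hS hs) (hS (hrS _)) ?_
    rw [← leadingCoeffs_eq_iff hN L (hsub hs (hrS _)), hr]
  · rw [Set.disjoint_left]
    rintro _ ⟨b, hb, rfl⟩ ⟨c, hc, hcb⟩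
    have hmem := sub_mem_Wset_of_mul_eq_mul hN hℓ1 (hS (hrS _)) (hS (hrS _)) hb hc hcb.symm
    rw [← leadingCoeffs_eq_iff hN L (hsub (hrS _) (hrS _)), hr, hr] at hmem
    exact hij (e.symm.injective (Subtype.ext hmem))
end
end

section
/- Let γ denote the Euler–Mascheroni constant. For every real number c with c < (ln q)·e^{−γ}, there are only finitely many monic polynomials f ∈ F_q[Y] satisfying φ(f)·ln(ln(q^{deg f})) < c·q^{deg f}. Equivalently, the liminf, as deg f → ∞ over monic f ∈ F_q[Y], of φ(f)·ln(ln(q^{deg f}))/q^{deg f} is at least (ln q)·e^{−γ}. -/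
noncomputable section

open Polynomial
open scoped Classical

variable (Fq : Type) [Field Fq] [Fintype Fq]

/-- The Euler function of `R_v = F_q[Y]`: `φ(f) = Card (F_q[Y]/(f))ˣ`. -/
def phiP (f : Polynomial Fq) : ℕ := Nat.card (Polynomial Fq ⧸ Ideal.span {f})ˣ

/-- `ω(f)`: the number of distinct monic irreducible factors of `f`. -/
def omegaP (f : Polynomial Fq) : ℕ :=
  (UniqueFactorizationMonoid.normalizedFactors f).toFinset.card

open UniqueFactorizationMonoid

theorem natCard_quotient_span_singleton {f : Fq[X]} (hf : f ≠ 0) :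
    Nat.card (Fq[X] ⧸ Ideal.span {f}) = Fintype.card Fq ^ f.natDegree := by
  have : Module.Finite Fq (Fq[X] ⧸ Ideal.span {f}) :=
    Module.Finite.of_basis (AdjoinRoot.powerBasis hf).basis
  rw [Module.natCard_eq_pow_finrank (K := Fq), finrank_quotient_span_eq_natDegree,
    Nat.card_eq_fintype_card]

theorem finite_quotient_span_singleton {f : Fq[X]} (hf : f ≠ 0) :
    Finite (Fq[X] ⧸ Ideal.span {f}) :=
  Nat.finite_of_card_ne_zero <| by
    rw [natCard_quotient_span_singleton Fq hf]
    exact pow_ne_zero _ Fintype.card_ne_zero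

omit [Fintype Fq] in
theorem phiP_of_isUnit {f : Fq[X]} (hf : IsUnit f) : phiP Fq f = 1 := by
  have : Subsingleton (Fq[X] ⧸ Ideal.span {f}) := by
    rw [Ideal.span_singleton_eq_top.mpr hf]
    infer_instance
  exact Nat.card_unique

omit [Fintype Fq] in
theorem phiP_mul_of_isCoprime {f g : Fq[X]} (h : IsCoprime f g) :
    phiP Fq (f * g) = phiP Fq f * phiP Fq g := by
  have e := Ideal.quotientMulEquivQuotientProd (Ideal.span {f}) (Ideal.span {g})
    (Ideal.isCoprime_span_singleton_iff f g |>.mpr h)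
  rw [Ideal.span_singleton_mul_span_singleton] at e
  rw [phiP, phiP, phiP, ← Nat.card_prod]
  exact Nat.card_congr ((Units.mapEquiv e.toMulEquiv).trans MulEquiv.prodUnits).toEquiv

theorem natCard_units_add_natCard_not_isUnit (A : Type*) [Monoid A] [Finite A] :
    Nat.card Aˣ + Nat.card {x : A // ¬ IsUnit x} = Nat.card A := by
  have h : Nat.card Aˣ = Nat.card {x : A // IsUnit x} :=
    Nat.card_congr Submonoid.unitsTypeEquivIsUnitSubmonoid.toEquiv
  rw [h, ← Nat.card_sum]
  exact Nat.card_congr (Equiv.sumCompl _)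

theorem phiP_prime_pow_mul {p : Fq[X]} (hp : Prime p) {n : ℕ} (hn : n ≠ 0) :
    phiP Fq (p ^ n) * Fintype.card Fq ^ p.natDegree +
      Fintype.card Fq ^ (p ^ n).natDegree =
      Fintype.card Fq ^ (p ^ n).natDegree * Fintype.card Fq ^ p.natDegree := by
  have hmax : (Ideal.span {p}).IsMaximal :=
    PrincipalIdealRing.isMaximal_of_irreducible hp.irreducible
  have hpn : p ^ n ≠ 0 := pow_ne_zero _ hp.ne_zero
  have := finite_quotient_span_singleton Fq hpn
  have hle : Ideal.span {p ^ n} ≤ Ideal.span {p} :=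
    Ideal.span_singleton_le_span_singleton.mpr (dvd_pow_self p hn)
  let π := Ideal.Quotient.factor hle
  have hπ : Function.Surjective π := Ideal.Quotient.factor_surjective hle
  have hunit (x : Fq[X] ⧸ Ideal.span {p ^ n}) : ¬ IsUnit x ↔ x ∈ π.toAddMonoidHom.ker := by
    obtain ⟨y, rfl⟩ := Ideal.Quotient.mk_surjective x
    have := Ideal.Quotient.isUnit_mk_pow_iff_notMem (Ideal.span {p}) hn (x := y)
    rw [Ideal.span_singleton_pow] at this
    rw [this, not_not, ← Ideal.Quotient.eq_zero_iff_mem]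
    rfl
  have hrange : π.toAddMonoidHom.range = ⊤ := AddMonoidHom.range_eq_top.mpr hπ
  have hcard := π.toAddMonoidHom.ker.card_mul_index
  rw [AddSubgroup.index_ker, hrange, AddSubgroup.card_top,
    natCard_quotient_span_singleton Fq hp.ne_zero, natCard_quotient_span_singleton Fq hpn] at hcard
  have hsum := natCard_units_add_natCard_not_isUnit (Fq[X] ⧸ Ideal.span {p ^ n})
  rw [Nat.card_congr (Equiv.subtypeEquivRight hunit),
    natCard_quotient_span_singleton Fq hpn] at hsum
  nth_rw 1 [← hcard]
  rw [← hsum, phiP, add_mul]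

theorem phiP_eq_prod {f : Fq[X]} (hf : f ≠ 0) :
    (phiP Fq f : ℝ) = (Fintype.card Fq : ℝ) ^ f.natDegree *
      ∏ P ∈ primeFactors f, (1 - ((Fintype.card Fq : ℝ) ^ P.natDegree)⁻¹) := by
  have hq : (Fintype.card Fq : ℝ) ≠ 0 := by simp
  induction f using induction_on_coprime with
  | h0 => exact absurd rfl hf
  | h1 h => simp [phiP_of_isUnit Fq h, primeFactors_of_isUnit h, natDegree_eq_zero_of_isUnit h]
  | @hpr p i hp =>
    rcases eq_or_ne i 0 with rfl | hi
    · simp [phiP_of_isUnit Fq isUnit_one]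
    · have h := congr_arg (Nat.cast (R := ℝ)) (phiP_prime_pow_mul Fq hp hi)
      push_cast at h
      have hpf : primeFactors p = {normalize p} := by
        rw [primeFactors, normalizedFactors_irreducible hp.irreducible]
        simp
      have hd : (normalize p).natDegree = p.natDegree :=
        natDegree_eq_of_degree_eq degree_normalize
      rw [primeFactors_pow _ hi, hpf, Finset.prod_singleton, hd]
      field_simp
      linarith
  | @hcp f g hc hf' hg' =>
    obtain ⟨h1, h2⟩ := mul_ne_zero_iff.mp hf
    rw [phiP_mul_of_isCoprime Fq hc.isCoprime, Nat.cast_mul, hf' h1, hg' h2,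
      primeFactors_mul_eq_disjUnion hc, Finset.prod_disjUnion, natDegree_mul h1 h2, pow_add]
    ring

/-- The monic irreducible polynomials of degree `d ≥ 1`. -/
def monicIrreducibles (d : ℕ) : Finset Fq[X] :=
  (primeFactors (X ^ Fintype.card Fq ^ d - X : Fq[X])).filter (·.natDegree = d)

theorem X_pow_card_pow_sub_X_ne_zero {d : ℕ} (hd : d ≠ 0) :
    (X ^ Fintype.card Fq ^ d - X : Fq[X]) ≠ 0 :=
  FiniteField.X_pow_card_pow_sub_X_ne_zero Fq hd Fintype.one_lt_card

omit [Fintype Fq] in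
theorem mem_primeFactors_iff_monic {f P : Fq[X]} (hf : f ≠ 0) :
    P ∈ primeFactors f ↔ P.Monic ∧ Irreducible P ∧ P ∣ f := by
  rw [mem_primeFactors, mem_normalizedFactors_iff' hf]
  constructor
  · rintro ⟨h1, h2, h3⟩
    exact ⟨h2 ▸ monic_normalize h1.ne_zero, h1, h3⟩
  · rintro ⟨h1, h2, h3⟩
    exact ⟨h2, h1.normalize_eq_self, h3⟩

theorem mem_monicIrreducibles {d : ℕ} (hd : d ≠ 0) {P : Fq[X]} :
    P ∈ monicIrreducibles Fq d ↔ P.Monic ∧ Irreducible P ∧ P.natDegree = d := by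
  rw [monicIrreducibles, Finset.mem_filter,
    mem_primeFactors_iff_monic Fq (X_pow_card_pow_sub_X_ne_zero Fq hd), and_assoc, and_assoc]
  refine and_congr_right fun _ ↦ and_congr_right fun hP ↦ and_iff_right_of_imp fun h ↦ ?_
  rw [← Nat.card_eq_fintype_card, ← hP.natDegree_dvd_iff_dvd_X_pow_card_pow_sub_X, h]

omit [Fintype Fq] in
theorem sum_natDegree_primeFactors_le {f : Fq[X]} (hf : f ≠ 0) :
    ∑ P ∈ primeFactors f, P.natDegree ≤ f.natDegree := by
  have h := natDegree_le_of_dvd (radical_dvd_self (a := f)) hf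
  rwa [radical, natDegree_prod _ id fun P hP ↦
    ((mem_primeFactors_iff_monic Fq hf).mp hP).1.ne_zero] at h

theorem sum_divisors_mul_card_monicIrreducibles_le {N : ℕ} (hN : N ≠ 0) :
    ∑ d ∈ N.divisors, d * (monicIrreducibles Fq d).card ≤ Fintype.card Fq ^ N := by
  have hg := X_pow_card_pow_sub_X_ne_zero Fq hN
  have hmem {P : Fq[X]} : P ∈ primeFactors (X ^ Fintype.card Fq ^ N - X : Fq[X]) ↔
      P.Monic ∧ Irreducible P ∧ P.natDegree ∣ N := by
    rw [mem_primeFactors_iff_monic Fq hg]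
    refine and_congr_right fun _ ↦ and_congr_right fun hP ↦ ?_
    rw [hP.natDegree_dvd_iff_dvd_X_pow_card_pow_sub_X, Nat.card_eq_fintype_card]
  have h := sum_natDegree_primeFactors_le Fq hg
  rw [FiniteField.X_pow_card_pow_sub_X_natDegree_eq Fq hN Fintype.one_lt_card] at h
  refine le_of_eq_of_le ?_ h
  rw [← Finset.sum_fiberwise_of_maps_to (t := N.divisors) (g := natDegree)
    fun P hP ↦ Nat.mem_divisors.mpr ⟨(hmem.mp hP).2.2, hN⟩]
  refine Finset.sum_congr rfl fun d hd ↦ ?_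
  obtain ⟨hdN, -⟩ := Nat.mem_divisors.mp hd
  rw [Finset.sum_congr rfl fun P hP ↦ (Finset.mem_filter.mp hP).2, Finset.sum_const, smul_eq_mul,
    mul_comm]
  congr 2
  ext P
  rw [mem_monicIrreducibles Fq (ne_zero_of_dvd_ne_zero hN hdN), Finset.mem_filter, hmem]
  grind

theorem finite_setOf_natDegree_lt (n : ℕ) : {f : Fq[X] | f.natDegree < n}.Finite := by
  have : Finite (degreeLT Fq n) := Finite.of_equiv _ (degreeLTEquiv Fq n).symm.toEquiv
  refine (Set.toFinite (degreeLT Fq n : Set Fq[X])).subset fun f hf ↦ ?_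
  exact mem_degreeLT.mpr (degree_le_natDegree.trans_lt (by exact_mod_cast hf))

theorem neg_log_one_sub_le {x : ℝ} (h0 : 0 ≤ x) (h1 : x ≤ 1 / 2) (n : ℕ) :
    -Real.log (1 - x) ≤ ∑ i ∈ Finset.range n, x ^ (i + 1) / (i + 1) + 2 * x ^ (n + 1) := by
  have h := Real.abs_log_sub_add_sum_range_le (by rw [abs_of_nonneg h0]; linarith) n
  rw [abs_of_nonneg h0] at h
  have h2 : x ^ (n + 1) / (1 - x) ≤ 2 * x ^ (n + 1) := by
    rw [div_le_iff₀ (by linarith)]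
    nlinarith [pow_nonneg h0 (n + 1)]
  linarith [neg_abs_le (∑ i ∈ Finset.range n, x ^ (i + 1) / (i + 1) + Real.log (1 - x))]

theorem sum_Icc_sum_range_div_eq_sum_divisors (F : ℕ → ℕ → ℝ) (m : ℕ) :
    ∑ d ∈ Finset.Icc 1 m, ∑ i ∈ Finset.range (m / d), F d (d * (i + 1)) =
      ∑ N ∈ Finset.Icc 1 m, ∑ d ∈ N.divisors, F d N := by
  rw [Finset.sum_sigma', Finset.sum_sigma']
  refine Finset.sum_nbij' (fun x ↦ ⟨x.1 * (x.2 + 1), x.1⟩) (fun y ↦ ⟨y.2, y.1 / y.2 - 1⟩) ?_ ?_ ?_ ?_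
    fun _ _ ↦ rfl
  · rintro ⟨d, i⟩ h
    simp only [Finset.mem_sigma, Finset.mem_Icc, Finset.mem_range, Nat.mem_divisors] at h ⊢
    have h2 : d * (i + 1) ≤ m :=
      (Nat.mul_le_mul_left d h.2).trans (Nat.mul_div_le m d)
    have h3 : 0 < d * (i + 1) := Nat.mul_pos h.1.1 i.succ_pos
    exact ⟨⟨h3, h2⟩, dvd_mul_right _ _, h3.ne'⟩
  · rintro ⟨N, d⟩ h
    simp only [Finset.mem_sigma, Finset.mem_Icc, Finset.mem_range, Nat.mem_divisors] at h ⊢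
    have hd := Nat.pos_of_dvd_of_pos h.2.1 h.1.1
    have hdN := Nat.le_of_dvd h.1.1 h.2.1
    have h4 : 0 < N / d := Nat.div_pos hdN hd
    have h5 : N / d ≤ m / d := Nat.div_le_div_right h.1.2
    omega
  · rintro ⟨d, i⟩ h
    simp only [Finset.mem_sigma, Finset.mem_Icc] at h
    simp [Nat.mul_div_cancel_left _ h.1.1]
  · rintro ⟨N, d⟩ h
    simp only [Finset.mem_sigma, Finset.mem_Icc, Nat.mem_divisors] at h
    have hd := Nat.pos_of_dvd_of_pos h.2.1 h.1.1
    have h4 : 0 < N / d := Nat.div_pos (Nat.le_of_dvd h.1.1 h.2.1) hd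
    simp [Nat.sub_add_cancel h4, Nat.mul_div_cancel' h.2.1]

theorem half_le_mul_div {d m : ℕ} (hd : 1 ≤ d) (hdm : d ≤ m) : m / 2 ≤ d * (m / d) := by
  have h1 := Nat.div_add_mod m d
  have h2 := Nat.mod_lt m hd
  have h3 : d ≤ d * (m / d) := Nat.le_mul_of_pos_right d (Nat.div_pos hdm hd)
  omega

theorem inv_pow_le_half {q : ℕ} (hq : 2 ≤ q) {d : ℕ} (hd : 1 ≤ d) : ((q : ℝ) ^ d)⁻¹ ≤ 1 / 2 := by
  rw [one_div]
  gcongr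
  calc (2 : ℝ) ≤ q := by exact_mod_cast hq
    _ ≤ q ^ d := le_self_pow₀ (by exact_mod_cast (by omega : 1 ≤ q)) (by omega)

/-- A Mertens-type upper bound, for a counting function `a` of objects of degree `d` satisfying the
inequality of the prime polynomial theorem. -/
theorem sum_mul_neg_log_one_sub_le_harmonic_add {q : ℕ} (hq : 2 ≤ q) (a : ℕ → ℕ)
    (ha : ∀ N ≠ 0, ∑ d ∈ N.divisors, d * a d ≤ q ^ N) (m : ℕ) :
    ∑ d ∈ Finset.Icc 1 m, a d * -Real.log (1 - ((q : ℝ) ^ d)⁻¹) ≤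
      harmonic m + 2 * (m * (1 / 2 : ℝ) ^ (m / 2)) := by
  have hq0 : (0 : ℝ) < q := by exact_mod_cast (by omega : 0 < q)
  have hq2 : (2 : ℝ) ≤ q := by exact_mod_cast hq
  have htail {d : ℕ} (hd : d ∈ Finset.Icc 1 m) :
      a d * -Real.log (1 - ((q : ℝ) ^ d)⁻¹) ≤
        ∑ i ∈ Finset.range (m / d), (d * a d) * ((q : ℝ) ^ (d * (i + 1)))⁻¹ / ↑(d * (i + 1)) +
          2 * (1 / 2 : ℝ) ^ (m / 2) := by
    obtain ⟨hd1, hdm⟩ := Finset.mem_Icc.mp hd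
    have had : (a d : ℝ) ≤ q ^ d := by
      have h1 := Finset.single_le_sum (f := fun d ↦ d * a d) (fun _ _ ↦ Nat.zero_le _)
        (Nat.mem_divisors_self d (by omega))
      have h2 : a d ≤ q ^ d :=
        (Nat.le_mul_of_pos_left _ hd1).trans (h1.trans (ha d (by omega)))
      exact_mod_cast h2
    have hlog := neg_log_one_sub_le (by positivity) (inv_pow_le_half hq hd1) (m / d)
    calc a d * -Real.log (1 - ((q : ℝ) ^ d)⁻¹)
        ≤ a d * (∑ i ∈ Finset.range (m / d), ((q : ℝ) ^ d)⁻¹ ^ (i + 1) / (i + 1) +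
          2 * ((q : ℝ) ^ d)⁻¹ ^ (m / d + 1)) := by gcongr
      _ = ∑ i ∈ Finset.range (m / d), (d * a d) * ((q : ℝ) ^ (d * (i + 1)))⁻¹ / ↑(d * (i + 1)) +
          2 * (a d * ((q : ℝ) ^ d)⁻¹ ^ (m / d + 1)) := by
        rw [mul_add, Finset.mul_sum]
        congr 1
        · refine Finset.sum_congr rfl fun i _ ↦ ?_
          have : (d : ℝ) ≠ 0 := by exact_mod_cast (by omega : d ≠ 0)
          push_cast
          rw [inv_pow, ← pow_mul]
          field_simp
        · ring
      _ ≤ _ := by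
        gcongr
        calc a d * ((q : ℝ) ^ d)⁻¹ ^ (m / d + 1)
            ≤ q ^ d * ((q : ℝ) ^ d)⁻¹ ^ (m / d + 1) := by gcongr
          _ = (1 / q : ℝ) ^ (d * (m / d)) := by
            rw [pow_succ', mul_inv_cancel_left₀ (by positivity), inv_pow, ← pow_mul, one_div,
              inv_pow]
          _ ≤ (1 / 2 : ℝ) ^ (d * (m / d)) := by gcongr
          _ ≤ (1 / 2 : ℝ) ^ (m / 2) :=
            pow_le_pow_of_le_one (by norm_num) (by norm_num) (half_le_mul_div hd1 hdm)
  refine (Finset.sum_le_sum fun d hd ↦ htail hd).trans ?_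
  rw [Finset.sum_add_distrib, Finset.sum_const, Nat.card_Icc, nsmul_eq_mul, Nat.add_sub_cancel,
    sum_Icc_sum_range_div_eq_sum_divisors
      (fun d N ↦ (d * a d : ℝ) * ((q : ℝ) ^ N)⁻¹ / (N : ℝ))]
  refine add_le_add ?_ (le_of_eq (by ring))
  rw [harmonic_eq_sum_Icc]
  push_cast
  refine Finset.sum_le_sum fun N hN ↦ ?_
  have hN1 : N ≠ 0 := by have := (Finset.mem_Icc.mp hN).1; omega
  rw [← Finset.sum_div, ← Finset.sum_mul, ← one_div (N : ℝ)]
  gcongr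
  rw [← div_eq_mul_inv, div_le_one (by positivity)]
  exact_mod_cast ha N hN1

open Filter Topology in
theorem exists_forall_le_exp_neg_mul (q : ℕ) (hq : 2 ≤ q) (c : ℝ)
    (hc : c < Real.log q * Real.exp (-Real.eulerMascheroniConstant)) :
    ∃ M : ℕ, 1 ≤ M ∧ ∀ m ≥ M, 0 ≤ m * Real.log q + Real.log (Real.log q) ∧
      c ≤ Real.exp (-(harmonic m + 2 * (m * (1 / 2 : ℝ) ^ (m / 2)) + 2 * q / m)) *
        (m * Real.log q + Real.log (Real.log q)) := by
  have hlq : 0 < Real.log q := Real.log_pos (by exact_mod_cast (by omega : 1 < q))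
  have h1 : Tendsto (fun m : ℕ ↦ 2 * (m * (1 / 2 : ℝ) ^ (m / 2))) atTop (𝓝 0) := by
    have h2 : Tendsto (fun n : ℕ ↦ 2 * (2 * (n * (1 / 2 : ℝ) ^ n) + (1 / 2 : ℝ) ^ n)) atTop
        (𝓝 (2 * (2 * 0 + 0))) :=
      (((tendsto_self_mul_const_pow_of_lt_one (by norm_num) (by norm_num)).const_mul 2).add
        (tendsto_pow_atTop_nhds_zero_of_lt_one (by norm_num) (by norm_num))).const_mul 2
    have h3 := h2.comp (Nat.tendsto_div_const_atTop (show 2 ≠ 0 by norm_num))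
    norm_num only [mul_zero, add_zero] at h3
    refine squeeze_zero (fun m ↦ by positivity) (fun m ↦ ?_) h3
    have h4 : (m : ℝ) ≤ 2 * (m / 2 : ℕ) + 1 := by exact_mod_cast (by omega : m ≤ 2 * (m / 2) + 1)
    simp only [Function.comp]
    nlinarith [pow_pos (show (0 : ℝ) < 1 / 2 by norm_num) (m / 2)]
  have h2 : Tendsto (fun m : ℕ ↦ 2 * (q : ℝ) / m) atTop (𝓝 0) :=
    tendsto_const_div_atTop_nhds_zero_nat _
  have h3 : Tendsto (fun m : ℕ ↦ Real.log q + Real.log (Real.log q) / m) atTop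
      (𝓝 (Real.log q + 0)) :=
    (tendsto_const_div_atTop_nhds_zero_nat _).const_add _
  have h4 := (Real.continuous_exp.tendsto _).comp
    ((Real.tendsto_harmonic_sub_log.add h1).add h2).neg
  have h5 := h4.mul h3
  rw [add_zero, add_zero, add_zero, mul_comm (Real.exp _)] at h5
  have h6 := (h5.eventually_const_lt hc).and
    ((h3.eventually_const_lt (u := 0) (by simpa using hlq)).and (eventually_ge_atTop 1))
  obtain ⟨M, hM⟩ := eventually_atTop.mp h6
  refine ⟨max M 1, le_max_right _ _, fun m hm ↦ ?_⟩
  obtain ⟨hc', hpos, hm1⟩ := hM m ((le_max_left _ _).trans hm)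
  have hm0 : (0 : ℝ) < m := by exact_mod_cast hm1
  have hB : m * Real.log q + Real.log (Real.log q) =
      m * (Real.log q + Real.log (Real.log q) / m) := by field_simp
  rw [hB]
  refine ⟨by positivity, hc'.le.trans (le_of_eq ?_)⟩
  rw [← mul_assoc]
  congr 1
  simp only [Function.comp]
  rw [show -((harmonic m : ℝ) - Real.log m + 2 * (m * (1 / 2 : ℝ) ^ (m / 2)) + 2 * q / m) =
    -(harmonic m + 2 * (m * (1 / 2 : ℝ) ^ (m / 2)) + 2 * q / m) + Real.log m by ring,
    Real.exp_add, Real.exp_log hm0]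

/-- Up to degree `m` the prime factors are among all primes, and there are at most
`f.natDegree / m` prime factors of larger degree. -/
theorem sum_primeFactors_neg_log_le {f : Fq[X]} (hf : f ≠ 0) {m : ℕ} (hm : 1 ≤ m)
    (hfm : f.natDegree ≤ Fintype.card Fq ^ (m + 1)) :
    ∑ P ∈ primeFactors f, -Real.log (1 - ((Fintype.card Fq : ℝ) ^ P.natDegree)⁻¹) ≤
      harmonic m + 2 * (m * (1 / 2 : ℝ) ^ (m / 2)) + 2 * Fintype.card Fq / m := by
  have hq : 2 ≤ Fintype.card Fq := Fintype.one_lt_card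
  set q := Fintype.card Fq
  have hq0 : (0 : ℝ) < q := by exact_mod_cast (by omega : 0 < q)
  have hm0 : (0 : ℝ) < m := by exact_mod_cast hm
  have hP {P : Fq[X]} (h : P ∈ primeFactors f) : P.Monic ∧ Irreducible P ∧ 1 ≤ P.natDegree := by
    obtain ⟨h1, h2, -⟩ := (mem_primeFactors_iff_monic Fq hf).mp h
    exact ⟨h1, h2, h2.natDegree_pos⟩
  have hlog_nonneg {d : ℕ} (hd : 1 ≤ d) : 0 ≤ -Real.log (1 - ((q : ℝ) ^ d)⁻¹) := by
    have h1 := inv_pow_le_half hq hd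
    have h2 : 0 ≤ ((q : ℝ) ^ d)⁻¹ := by positivity
    exact neg_nonneg.mpr (Real.log_nonpos (by linarith) (by linarith))
  rw [← Finset.sum_filter_add_sum_filter_not _ (fun P ↦ P.natDegree ≤ m)]
  refine add_le_add ?_ ?_
  · refine le_trans ?_ (sum_mul_neg_log_one_sub_le_harmonic_add hq
      (fun d ↦ (monicIrreducibles Fq d).card)
      (fun N hN ↦ sum_divisors_mul_card_monicIrreducibles_le Fq hN) m)
    rw [← Finset.sum_fiberwise_of_maps_to (t := Finset.Icc 1 m) (g := natDegree)
      fun P h ↦ by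
        obtain ⟨h1, h2⟩ := Finset.mem_filter.mp h
        exact Finset.mem_Icc.mpr ⟨(hP h1).2.2, h2⟩]
    refine Finset.sum_le_sum fun d hd ↦ ?_
    have hd1 := (Finset.mem_Icc.mp hd).1
    rw [Finset.sum_congr rfl fun P h ↦ by rw [(Finset.mem_filter.mp h).2], Finset.sum_const,
      nsmul_eq_mul]
    refine mul_le_mul_of_nonneg_right ?_ (hlog_nonneg hd1)
    refine Nat.cast_le.mpr (Finset.card_le_card fun P h ↦ ?_)
    simp only [Finset.mem_filter] at h
    obtain ⟨h1, h2, -⟩ := hP h.1.1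
    exact (mem_monicIrreducibles Fq (by omega)).mpr ⟨h1, h2, h.2⟩
  · set S := (primeFactors f).filter (fun P ↦ ¬ P.natDegree ≤ m)
    have hS : S.card * m ≤ f.natDegree := calc
      S.card * m ≤ ∑ P ∈ S, P.natDegree := by
        rw [← smul_eq_mul]
        exact Finset.card_nsmul_le_sum _ _ _ fun P h ↦ (not_le.mp (Finset.mem_filter.mp h).2).le
      _ ≤ ∑ P ∈ primeFactors f, P.natDegree :=
        Finset.sum_le_sum_of_subset (Finset.filter_subset _ _)
      _ ≤ f.natDegree := sum_natDegree_primeFactors_le Fq hf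
    have hS' : (S.card : ℝ) * m ≤ q ^ (m + 1) := by exact_mod_cast hS.trans hfm
    have hterm {P : Fq[X]} (h : P ∈ S) :
        -Real.log (1 - ((q : ℝ) ^ P.natDegree)⁻¹) ≤ 2 * ((q : ℝ) ^ m)⁻¹ := by
      obtain ⟨h1, h2⟩ := Finset.mem_filter.mp h
      have h3 := neg_log_one_sub_le (by positivity) (inv_pow_le_half hq (hP h1).2.2) 0
      simp only [Finset.range_zero, Finset.sum_empty, zero_add, pow_one] at h3
      refine h3.trans ?_
      gcongr
      · exact_mod_cast (by omega : 1 ≤ q)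
      · omega
    calc _ ≤ S.card • (2 * ((q : ℝ) ^ m)⁻¹) := Finset.sum_le_card_nsmul _ _ _ fun P h ↦ hterm h
      _ = 2 * (S.card * m) * ((q : ℝ) ^ m)⁻¹ / m := by
        rw [nsmul_eq_mul]
        field_simp
      _ ≤ 2 * q ^ (m + 1) * ((q : ℝ) ^ m)⁻¹ / m := by gcongr
      _ = 2 * q / m := by
        rw [pow_succ]
        field_simp

theorem pow_mul_exp_le_phiP {f : Fq[X]} (hf : f ≠ 0) {m : ℕ} (hm : 1 ≤ m)
    (hfm : f.natDegree ≤ Fintype.card Fq ^ (m + 1)) :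
    (Fintype.card Fq : ℝ) ^ f.natDegree *
      Real.exp (-(harmonic m + 2 * (m * (1 / 2 : ℝ) ^ (m / 2)) + 2 * Fintype.card Fq / m)) ≤
      phiP Fq f := by
  have hq : 2 ≤ Fintype.card Fq := Fintype.one_lt_card
  have hprod : ∏ P ∈ primeFactors f, (1 - ((Fintype.card Fq : ℝ) ^ P.natDegree)⁻¹) =
      Real.exp (-∑ P ∈ primeFactors f,
        -Real.log (1 - ((Fintype.card Fq : ℝ) ^ P.natDegree)⁻¹)) := by
    rw [Finset.sum_neg_distrib, neg_neg, Real.exp_sum]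
    refine Finset.prod_congr rfl fun P h ↦ (Real.exp_log ?_).symm
    have h1 := ((mem_primeFactors_iff_monic Fq hf).mp h).2.1.natDegree_pos
    linarith [inv_pow_le_half hq h1]
  rw [phiP_eq_prod Fq hf, hprod]
  gcongr
  exact sum_primeFactors_neg_log_le Fq hf hm hfm

/-- **Mertens-type lower bound** (Lemma 2.3 of the paper, for `R_v = F_q[Y]`): for every
`c < (ln q) e^{-γ}`, only finitely many monic `f ∈ F_q[Y]` satisfy
`φ(f) ln(ln(q^{deg f})) < c q^{deg f}`; i.e. the liminf of
`φ(f) ln(ln(q^{deg f}))/q^{deg f}` is at least `(ln q) e^{-γ}`. -/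
theorem euler_phi_liminf_lower_bound (c : ℝ)
    (hc : c < Real.log (Fintype.card Fq) * Real.exp (-Real.eulerMascheroniConstant)) :
    {f : Polynomial Fq | f.Monic ∧
      (phiP Fq f : ℝ) * Real.log (Real.log ((Fintype.card Fq : ℝ) ^ f.natDegree)) <
        c * (Fintype.card Fq : ℝ) ^ f.natDegree}.Finite := by
  have hq : 2 ≤ Fintype.card Fq := Fintype.one_lt_card
  obtain ⟨M, hM1, hM⟩ := exists_forall_le_exp_neg_mul _ hq c hc
  refine (finite_setOf_natDegree_lt Fq (Fintype.card Fq ^ M)).subset fun f ⟨hf, hlt⟩ ↦ ?_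
  by_contra h_not_lt
  have hge : Fintype.card Fq ^ M ≤ f.natDegree := not_lt.mp h_not_lt
  have hn : f.natDegree ≠ 0 := (lt_of_lt_of_le (by positivity) hge).ne'
  set m := Nat.log (Fintype.card Fq) f.natDegree
  have hMm : M ≤ m := Nat.le_log_of_pow_le hq hge
  have hphi := pow_mul_exp_le_phiP Fq hf.ne_zero (hM1.trans hMm)
    (Nat.lt_pow_succ_log_self hq _).le
  obtain ⟨hB, hcm⟩ := hM m hMm
  have hlq : 0 < Real.log (Fintype.card Fq) := Real.log_pos (by exact_mod_cast hq)
  have hloglog : m * Real.log (Fintype.card Fq) + Real.log (Real.log (Fintype.card Fq)) ≤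
      Real.log (Real.log ((Fintype.card Fq : ℝ) ^ f.natDegree)) := by
    rw [Real.log_pow, Real.log_mul (by exact_mod_cast hn) hlq.ne', ← Real.log_pow]
    gcongr
    exact_mod_cast Nat.pow_log_le_self _ hn
  refine hlt.not_ge ?_
  refine (mul_le_mul_of_nonneg_right hcm (by positivity)).trans ?_
  rw [mul_right_comm, mul_comm (Real.exp _)]
  exact mul_le_mul hphi hloglog hB (Nat.cast_nonneg _)
end
end
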